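/- arXiv:0812.1289 — 2 statements merged into one kernel-verified Lean document; each statement's English description precedes it below -/
import Mathlib

section
/- Let R be a commutative noetherian ring, let a ⊆ b be ideals of R, let X be an arbitrary R-module, and let n be a non-negative integer. If H^i_a(X) is b-torsion for all i ≥ n, then H^i_a(X) ≅ H^i_b(X) for all i ≥ n + ara(b/a). -/
open CategoryTheory

/-- An `R`-module `Y` is `b`-torsion if every element is annihilated by some power of `b`. -/
def IsTorsionWrt {R : Type} [CommRing R] (b : Ideal R) (Y : ModuleCat R) : Prop :=
  ∀ x : Y, ∃ k : ℕ, ∀ r ∈ b ^ k, r • x = 0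

/-- For ideals `a ⊆ b`, the relative arithmetic rank `ara(b/a)`: the least `n` such that there
are `x₁, ..., xₙ ∈ R` with `√((x₁,...,xₙ) + a) = √b`. -/
noncomputable def araRankRel {R : Type} [CommRing R] (a b : Ideal R) : ℕ :=
  sInf {n : ℕ | ∃ f : Fin n → R, (Ideal.span (Set.range f) + a).radical = b.radical}

section localCohomologyProof

noncomputable def linMap {R : Type} [CommRing R] {K L : ChainComplex (ModuleCat.{0} R) ℕ} (φ : K ⟶ L) (Y : ModuleCat.{0} R) :
    L.linearYonedaObj R Y ⟶ K.linearYonedaObj R Y :=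
  (HomologicalComplex.unopFunctor _ _).map ((((linearYoneda R (ModuleCat R)).obj Y).rightOp.mapHomologicalComplex _).map φ).op

lemma linMap_f {R : Type} [CommRing R] {K L : ChainComplex (ModuleCat.{0} R) ℕ} (φ : K ⟶ L) (Y : ModuleCat.{0} R) (n : ℕ) (f : L.X n ⟶ Y) :
   ((linMap φ Y).f n).hom f = (φ.f n ≫ f : K.X n ⟶ Y) := rfl

lemma sqInv {C : Type*} [Category C] {A B A' B' : C} (f : A ⟶ B) (g : A' ⟶ B') (e' : A ≅ A') (e : B ≅ B')
    (h : f ≫ e.hom = e'.hom ≫ g) : e'.inv ≫ f = g ≫ e.inv := by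
  rw [Iso.inv_comp_eq, ← Category.assoc, Iso.eq_comp_inv, h]

lemma isoExt_nat {R : Type} [CommRing R] {X X' : ModuleCat.{0} R} (P' : ProjectiveResolution X') (P : ProjectiveResolution X)
   (g : X' ⟶ X) (φ : ProjectiveResolution.Hom P' P g) (n : ℕ) (Y : ModuleCat.{0} R) :
   ((Ext R (ModuleCat R) n).map g.op).app Y ≫ (P'.isoExt n Y).hom =
     (P.isoExt n Y).hom ≫ HomologicalComplex.homologyMap (linMap φ.hom Y) n := by
  have h1 := ProjectiveResolution.isoLeftDerivedObj_inv_naturality g P' P φ.hom (by simpa using φ.hom_f_zero_comp_π_f_zero) ((linearYoneda R (ModuleCat R)).obj Y).rightOp n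
  have h2 := HomologicalComplex.homologyOp_hom_naturality (linMap φ.hom Y) n
  have h2a : (HomologicalComplex.homologyOp (P'.complex.linearYonedaObj R Y) n).inv ≫ HomologicalComplex.homologyMap
        ((HomologicalComplex.opFunctor (ModuleCat R) (ComplexShape.up ℕ)).map (linMap φ.hom Y).op) n =
        (HomologicalComplex.homologyMap (linMap φ.hom Y) n).op ≫ (HomologicalComplex.homologyOp (P.complex.linearYonedaObj R Y) n).inv := by
    exact sqInv _ _ _ _ h2
  have h1' := congrArg Quiver.Hom.unop h1
  have h2' := congrArg Quiver.Hom.unop h2a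
  have h3 := congrArg (fun t => t ≫ (HomologicalComplex.homologyOp (P'.complex.linearYonedaObj R Y) n).inv.unop) h1'
  have h4 := congrArg (fun t => (P.isoLeftDerivedObj ((linearYoneda R (ModuleCat R)).obj Y).rightOp n).inv.unop ≫ t) h2'
  exact h3.trans h4

section cls
variable {R : Type} [CommRing R] (K : CochainComplex (ModuleCat.{0} R) ℕ) (n : ℕ)

noncomputable def cycIn : ModuleCat.of R (LinearMap.ker (K.d n (n+1)).hom) ⟶ K.cycles n :=
  K.liftCycles (ModuleCat.ofHom (LinearMap.ker (K.d n (n+1)).hom).subtype) (n+1) (by simp)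
    (by ext z; exact z.2)

lemma cycIn_i (z) : (K.iCycles n).hom ((cycIn K n).hom z) = z.1 := by
  have : cycIn K n ≫ K.iCycles n = ModuleCat.ofHom (LinearMap.ker (K.d n (n+1)).hom).subtype := by
    simp [cycIn]
  exact congrArg (fun t => t.hom z) this

lemma iCyc_inj : Function.Injective (K.iCycles n).hom :=
  (ModuleCat.mono_iff_injective (K.iCycles n)).1 inferInstance

noncomputable def clsHom : LinearMap.ker (K.d n (n+1)).hom →ₗ[R] K.homology n :=
  (cycIn K n ≫ K.homologyπ n).hom

lemma clsHom_apply (z) : clsHom K n z = (K.homologyπ n).hom ((cycIn K n).hom z) := rfl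

lemma clsHom_surj : Function.Surjective (clsHom K n) := by
  intro y
  obtain ⟨c, rfl⟩ := (ModuleCat.epi_iff_surjective (K.homologyπ n)).1 inferInstance y
  refine ⟨⟨(K.iCycles n).hom c, ?_⟩, ?_⟩
  · have := K.iCycles_d n (n+1)
    exact congrArg (fun t => t.hom c) this
  · rw [clsHom_apply]
    congr 1
    apply iCyc_inj
    rw [cycIn_i]

lemma clsHom_eq_zero_iff (z) : clsHom K n z = 0 ↔
    ∃ w, (K.d ((ComplexShape.up ℕ).prev n) n).hom w = z.1 := by
  have ex : (ShortComplex.mk (K.toCycles ((ComplexShape.up ℕ).prev n) n) (K.homologyπ n) (by simp)).Exact :=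
    ShortComplex.exact_of_g_is_cokernel _ (K.homologyIsCokernel _ n rfl)
  have key : ∀ w, (K.iCycles n).hom ((K.toCycles ((ComplexShape.up ℕ).prev n) n).hom w) = (K.d ((ComplexShape.up ℕ).prev n) n).hom w := by
    intro w
    exact congrArg (fun t => t.hom w) (K.toCycles_i ((ComplexShape.up ℕ).prev n) n)
  constructor
  · intro h
    obtain ⟨w, hw⟩ := (ShortComplex.moduleCat_exact_iff _).1 ex ((cycIn K n).hom z) h
    refine ⟨w, ?_⟩
    rw [← key, ← cycIn_i]
    exact congrArg _ hw
  · rintro ⟨w, hw⟩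
    have : (cycIn K n).hom z = (K.toCycles ((ComplexShape.up ℕ).prev n) n).hom w := by
      apply iCyc_inj
      rw [key, cycIn_i, hw]
    rw [clsHom_apply, this]
    exact congrArg (fun t => t.hom w) (K.toCycles_comp_homologyπ ((ComplexShape.up ℕ).prev n) n)

lemma clsHom_map {K L : CochainComplex (ModuleCat.{0} R) ℕ} (φ : K ⟶ L) (n : ℕ) (z) (z')
    (h : z'.1 = (φ.f n).hom z.1) :
    (HomologicalComplex.homologyMap φ n).hom (clsHom K n z) = clsHom L n z' := by
  rw [clsHom_apply, clsHom_apply]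
  have e := congrArg (fun t => t.hom ((cycIn K n).hom z)) (HomologicalComplex.homologyπ_naturality φ n)
  refine Eq.trans e ?_
  change (L.homologyπ n).hom ((HomologicalComplex.cyclesMap φ n).hom ((cycIn K n).hom z)) = _
  congr 1
  apply iCyc_inj
  rw [cycIn_i, h, ← cycIn_i]
  exact congrArg (fun t => t.hom ((cycIn K n).hom z)) (HomologicalComplex.cyclesMap_i φ n)
end cls
open Abelian CochainComplex HomComplex

lemma inj_extMk_zero {R : Type} [CommRing R] {M X : ModuleCat.{0} R} (I : InjectiveResolution X)
    (f : M ⟶ I.cocomplex.X 0) (m : ℕ) (hm : 0 + 1 = m)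
    (hf : f ≫ I.cocomplex.d 0 m = 0) : I.extMk f m hm hf = 0 ↔ f = 0 := by
  constructor
  · intro h
    rw [← I.extEquivCohomologyClass.apply_eq_iff_eq,
      InjectiveResolution.extEquivCohomologyClass_extMk, InjectiveResolution.extEquivCohomologyClass_zero,
      CohomologyClass.mk_eq_zero_iff, Cocycle.fromSingleMk_mem_coboundaries_iff _ _ _ _ _ (-1) (by simp)] at h
    obtain ⟨g, hg⟩ := h
    have hz : Limits.IsZero (I.cochainComplex.X (-1)) := I.cochainComplex.isZero_of_isStrictlyGE 0 (-1)
    rw [hz.eq_of_tgt g 0, Limits.zero_comp] at hg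
    rw [← cancel_mono (I.cochainComplexXIso (0:ℕ) 0 rfl).inv, ← hg, Limits.zero_comp]
  · rintro rfl; simp

lemma proj_extMk_zero {R : Type} [CommRing R] {M X : ModuleCat.{0} R} (P : ProjectiveResolution M)
    (f : P.complex.X 0 ⟶ X) (m : ℕ) (hm : 0 + 1 = m)
    (hf : P.complex.d m 0 ≫ f = 0) : P.extMk f m hm hf = 0 ↔ f = 0 := by
  constructor
  · intro h
    rw [← P.extEquivCohomologyClass.apply_eq_iff_eq,
      ProjectiveResolution.extEquivCohomologyClass_extMk, ProjectiveResolution.extEquivCohomologyClass_zero,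
      CohomologyClass.mk_eq_zero_iff, Cocycle.toSingleMk_mem_coboundaries_iff _ _ _ _ _ 1 (by simp)] at h
    obtain ⟨g, hg⟩ := h
    have hz : Limits.IsZero (P.cochainComplex.X 1) := P.cochainComplex.isZero_of_isStrictlyLE 0 1
    rw [hz.eq_of_src g 0, Limits.comp_zero] at hg
    rw [← cancel_epi (P.cochainComplexXIso (-(0:ℕ)) 0 rfl).hom, ← hg, Limits.comp_zero]
  · rintro rfl; simp

section bridge
variable {R : Type} [CommRing R]

noncomputable abbrev oldExt (i : ℕ) (M X : ModuleCat.{0} R) : ModuleCat.{0} R :=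
  ((_root_.Ext R (ModuleCat.{0} R) i).obj (Opposite.op M)).obj X

noncomputable def oldMk {M X : ModuleCat.{0} R} (P : ProjectiveResolution M) {i : ℕ} (f : P.complex.X i ⟶ X)
    (hf : P.complex.d (i+1) i ≫ f = 0) : oldExt i M X :=
  (P.isoExt i X).inv.hom (clsHom (P.complex.linearYonedaObj R X) i ⟨f, hf⟩)

lemma oldMk_surj {M X : ModuleCat.{0} R} (P : ProjectiveResolution M) {i : ℕ} (y : oldExt i M X) :
    ∃ f hf, oldMk P (i := i) (X := X) f hf = y := by
  obtain ⟨⟨f, hf⟩, h⟩ := clsHom_surj (P.complex.linearYonedaObj R X) i ((P.isoExt (R := R) i X).hom.hom y)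
  refine ⟨f, hf, ?_⟩
  unfold oldMk
  erw [h]
  exact congrArg (fun t => t.hom y) (P.isoExt (R := R) i X).hom_inv_id

lemma isoInv_inj {A B : ModuleCat.{0} R} (e : A ≅ B) : Function.Injective e.inv.hom :=
  (ModuleCat.mono_iff_injective e.inv).1 inferInstance

lemma oldMk_eq_zero_iff {M X : ModuleCat.{0} R} (P : ProjectiveResolution M) {i : ℕ} (f : P.complex.X i ⟶ X)
    (hf) : oldMk P f hf = 0 ↔ P.extMk f (i+1) rfl hf = 0 := by
  unfold oldMk
  rw [map_eq_zero_iff _ (isoInv_inj _), clsHom_eq_zero_iff]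
  rcases i with _ | p
  · rw [proj_extMk_zero]
    constructor
    · rintro ⟨w, hw⟩
      rw [← show _ = f from hw]
      rw [HomologicalComplex.shape _ _ _ (by simp)]
      rfl
    · rintro rfl
      exact ⟨0, map_zero _⟩
  · rw [P.extMk_eq_zero_iff _ _ _ _ p rfl]
    have : (ComplexShape.up ℕ).prev (p+1) = p := by simp
    rw [this]
    rfl

lemma oldMk_sub {M X : ModuleCat.{0} R} (P : ProjectiveResolution M) {i : ℕ} (f g : P.complex.X i ⟶ X)
    (hf hg) (hfg) : oldMk P (f - g) hfg = oldMk P f hf - oldMk P g hg := by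
  unfold oldMk
  rw [← map_sub, ← map_sub]
  rfl

lemma oldMk_smul {M X : ModuleCat.{0} R} (P : ProjectiveResolution M) {i : ℕ} (r : R) (f : P.complex.X i ⟶ X)
    (hf) (hrf) : oldMk P (r • f) hrf = r • oldMk P f hf := by
  unfold oldMk
  rw [← map_smul, ← map_smul]
  rfl

lemma oldMk_map {M M' X : ModuleCat.{0} R} (P : ProjectiveResolution M) (P' : ProjectiveResolution M')
    (g : M' ⟶ M) (φ : ProjectiveResolution.Hom P' P g) {i : ℕ} (f : P.complex.X i ⟶ X) (hf) (hf') :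
    (((_root_.Ext R (ModuleCat R) i).map g.op).app X).hom (oldMk P f hf) = oldMk P' (φ.hom.f i ≫ f) hf' := by
  have h := sqInv _ _ _ _ (isoExt_nat P' P g φ i X)
  have h2 := congrArg (fun t => t.hom (clsHom (P.complex.linearYonedaObj R X) i ⟨f, hf⟩)) h
  refine Eq.trans h2 ?_
  change (P'.isoExt i X).inv.hom ((HomologicalComplex.homologyMap (linMap φ.hom X) i).hom _) = _
  unfold oldMk
  congr 1
  exact clsHom_map _ _ _ _ rfl

/-- the comparison relation -/
def ER {X : ModuleCat.{0} R} (I : InjectiveResolution X) {i : ℕ} (M : ModuleCat.{0} R) (y : oldExt i M X)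
    (h : M ⟶ I.cocomplex.X i) : Prop :=
  ∃ (hh : h ≫ I.cocomplex.d i (i+1) = 0) (f : (projectiveResolution M).complex.X i ⟶ X)
    (hf : (projectiveResolution M).complex.d (i+1) i ≫ f = 0),
    oldMk _ f hf = y ∧ (projectiveResolution M).extMk f (i+1) rfl hf = I.extMk h (i+1) rfl hh

variable {X : ModuleCat.{0} R} (I : InjectiveResolution X) {i : ℕ}

lemma ER_exists_h {M : ModuleCat.{0} R} (y : oldExt i M X) : ∃ h, ER I M y h := by
  obtain ⟨f, hf, rfl⟩ := oldMk_surj (projectiveResolution M) y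
  obtain ⟨h, hh, e⟩ := I.extMk_surjective ((projectiveResolution M).extMk f (i+1) rfl hf) (i+1) rfl
  exact ⟨h, hh, f, hf, rfl, e.symm⟩

lemma ER_exists_y {M : ModuleCat.{0} R} (h : M ⟶ I.cocomplex.X i) (hh : h ≫ I.cocomplex.d i (i+1) = 0) :
    ∃ y, ER I M y h := by
  obtain ⟨f, hf, e⟩ := (projectiveResolution M).extMk_surjective (I.extMk h (i+1) rfl hh) (i+1) rfl
  exact ⟨_, hh, f, hf, rfl, e⟩

lemma ER_zero_iff {M : ModuleCat.{0} R} {y : oldExt i M X} {h} (H : ER I M y h) :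
    y = 0 ↔ I.extMk h (i+1) rfl H.1 = 0 := by
  obtain ⟨hh, f, hf, rfl, e⟩ := H
  rw [oldMk_eq_zero_iff]
  exact iff_of_eq (congrArg (· = 0) e)

lemma ER_zero_iff_zero {M : ModuleCat.{0} R} {y : oldExt 0 M X} {h} (H : ER I M y h) :
    y = 0 ↔ h = 0 := by
  rw [ER_zero_iff I H, inj_extMk_zero]

lemma ER_zero_iff_succ {M : ModuleCat.{0} R} {y : oldExt (i+1) M X} {h} (H : ER I M y h) :
    y = 0 ↔ ∃ g : M ⟶ I.cocomplex.X i, g ≫ I.cocomplex.d i (i+1) = h := by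
  rw [ER_zero_iff I H, I.extMk_eq_zero_iff _ _ _ _ i rfl]

lemma ER_sub {M : ModuleCat.{0} R} {y y' : oldExt i M X} {h h'} (H : ER I M y h) (H' : ER I M y' h') :
    ER I M (y - y') (h - h') := by
  obtain ⟨hh, f, hf, rfl, e⟩ := H
  obtain ⟨hh', f', hf', rfl, e'⟩ := H'
  refine ⟨by simp [hh, hh'], f - f', by simp [hf, hf'], oldMk_sub _ _ _ _ _ _, ?_⟩
  rw [← ProjectiveResolution.sub_extMk (hf := hf) (hg := hf'), ← InjectiveResolution.sub_extMk (hf := hh) (hg := hh'), e, e']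

lemma ER_smul {M : ModuleCat.{0} R} {y : oldExt i M X} {h} (r : R) (H : ER I M y h) :
    ER I M (r • y) (r • h) := by
  obtain ⟨hh, f, hf, rfl, e⟩ := H
  refine ⟨by simp [hh], r • f, by simp [hf], oldMk_smul _ _ _ _ _, ?_⟩
  have e1 : (projectiveResolution M).extMk (r • f) (i+1) rfl (by simp [hf]) = r • (projectiveResolution M).extMk f (i+1) rfl hf := by
    rw [Abelian.Ext.smul_eq_comp_mk₀, ProjectiveResolution.extMk_comp_mk₀]
    congr 1 <;> simp
  have e2 : I.extMk (r • h) (i+1) rfl (by simp [hh]) = r • I.extMk h (i+1) rfl hh := by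
    have := I.mk₀_comp_extMk h (i+1) rfl hh (r • 𝟙 M)
    rw [Abelian.Ext.mk₀_smul, Abelian.Ext.smul_comp, Abelian.Ext.mk₀_id_comp] at this
    rw [this]
    congr 1 <;> simp
  rw [e1, e2, e]

lemma ER_map {M M' : ModuleCat.{0} R} (g : M' ⟶ M) {y : oldExt i M X} {h} (H : ER I M y h) :
    ER I M' ((((_root_.Ext R (ModuleCat R) i).map g.op).app X).hom y) (g ≫ h) := by
  obtain ⟨hh, f, hf, rfl, e⟩ := H
  let φ : ProjectiveResolution.Hom (projectiveResolution M') (projectiveResolution M) g :=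
    ⟨ProjectiveResolution.lift g _ _, by simpa using ProjectiveResolution.lift_commutes_zero g _ _⟩
  have hf' : (projectiveResolution M').complex.d (i+1) i ≫ φ.hom.f i ≫ f = 0 := by
    rw [← φ.hom.comm_assoc, hf, Limits.comp_zero]
  refine ⟨by simp [hh], φ.hom.f i ≫ f, hf', (oldMk_map _ _ g φ f hf hf').symm, ?_⟩
  rw [← ProjectiveResolution.mk₀_comp_extMk f (i+1) rfl hf φ, e, InjectiveResolution.mk₀_comp_extMk]
end bridge
section colim
variable {R : Type} [CommRing R]

noncomputable abbrev qM (a : Ideal R) (t : ℕ) : ModuleCat.{0} R := ModuleCat.of R (R ⧸ (a ^ t))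

noncomputable def qT (a : Ideal R) {s t : ℕ} (h : s ≤ t) : qM a t ⟶ qM a s :=
  ModuleCat.ofHom (Submodule.mapQ _ _ LinearMap.id (Ideal.pow_le_pow_right h))

lemma qT_one (a : Ideal R) {s t : ℕ} (h : s ≤ t) : (qT a h).hom (Submodule.Quotient.mk (1 : R)) = Submodule.Quotient.mk (1 : R) := by
  simp [qT]

noncomputable def transM (a : Ideal R) (i : ℕ) (X : ModuleCat.{0} R) {s t : ℕ} (h : s ≤ t) :
    oldExt i (qM a s) X ⟶ oldExt i (qM a t) X :=
  ((_root_.Ext R (ModuleCat R) i).map (qT a h).op).app X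

noncomputable def iot (a : Ideal R) (i : ℕ) (X : ModuleCat.{0} R) (t : ℕ) :
    oldExt i (qM a t) X ⟶ (localCohomology a i).obj X :=
  (Limits.colimit.ι (localCohomology.diagram (localCohomology.idealPowersDiagram a) i)
    (Opposite.op (Opposite.op t))).app X

lemma iot_w (a : Ideal R) (i : ℕ) (X : ModuleCat.{0} R) {s t : ℕ} (h : s ≤ t) :
    transM a i X h ≫ iot a i X t = iot a i X s := by
  have := Limits.colimit.w (localCohomology.diagram (localCohomology.idealPowersDiagram a) i)
    (homOfLE h).op.op
  exact congrArg (fun u => u.app X) this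

noncomputable def colX (a : Ideal R) (i : ℕ) (X : ModuleCat.{0} R) :
    Limits.IsColimit (((evaluation _ _).obj X).mapCocone (Limits.colimit.cocone
      (localCohomology.diagram (localCohomology.idealPowersDiagram a) i))) :=
  Limits.isColimitOfPreserves _ (Limits.colimit.isColimit _)

lemma iot_surj (a : Ideal R) (i : ℕ) (X : ModuleCat.{0} R) (y : (localCohomology a i).obj X) :
    ∃ t y0, (iot a i X t).hom y0 = y := by
  obtain ⟨j, y0, h⟩ := Limits.Concrete.isColimit_exists_rep _ (colX a i X) y
  exact ⟨j.unop.unop, y0, h⟩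

lemma iot_zero (a : Ideal R) (i : ℕ) (X : ModuleCat.{0} R) (t : ℕ) (y : oldExt i (qM a t) X)
    (h : (iot a i X t).hom y = 0) : ∃ s, ∃ hs : t ≤ s, (transM a i X hs).hom y = 0 := by
  have h2 : (((((evaluation _ _).obj X).mapCocone (Limits.colimit.cocone
      (localCohomology.diagram (localCohomology.idealPowersDiagram a) i))).ι.app (Opposite.op (Opposite.op t))).hom y) = 
      (((((evaluation _ _).obj X).mapCocone (Limits.colimit.cocone
      (localCohomology.diagram (localCohomology.idealPowersDiagram a) i))).ι.app (Opposite.op (Opposite.op t))).hom 0) := by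
    rw [map_zero]; exact h
  obtain ⟨k, f, g, e⟩ := (Limits.Concrete.isColimit_rep_eq_iff_exists _ (colX a i X) _ _).1 h2
  refine ⟨k.unop.unop, f.unop.unop.le, Eq.trans e ?_⟩
  exact map_zero _
end colim
section rep
variable {R : Type} [CommRing R] {X : ModuleCat.{0} R} (I : InjectiveResolution X)

noncomputable def one' (a : Ideal R) (t : ℕ) : qM a t := Submodule.Quotient.mk (1 : R)

lemma q_ext {a : Ideal R} {t : ℕ} {M : ModuleCat.{0} R} {f g : qM a t ⟶ M}
    (h : f.hom (one' a t) = g.hom (one' a t)) : f = g := by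
  apply ModuleCat.hom_ext; apply LinearMap.ext; intro x
  obtain ⟨r, rfl⟩ := Submodule.Quotient.mk_surjective _ x
  have : (Submodule.Quotient.mk r : R ⧸ (a ^ t)) = r • (one' a t : R ⧸ (a ^ t)) := by
    unfold one'
    rw [← Submodule.Quotient.mk_smul]; simp
  rw [this]
  change f.hom _ = g.hom _
  rw [map_smul, map_smul, h]

lemma q_ann {a : Ideal R} {t : ℕ} {M : ModuleCat.{0} R} (f : qM a t ⟶ M) :
    ∀ r ∈ a ^ t, r • f.hom (one' a t) = 0 := by
  intro r hr
  rw [← map_smul]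
  have : r • (one' a t : R ⧸ (a ^ t)) = 0 := by
    unfold one'
    rw [← Submodule.Quotient.mk_smul, Submodule.Quotient.mk_eq_zero]; simpa using hr
  erw [this]; exact map_zero _

lemma q_lift {a : Ideal R} {t : ℕ} {M : ModuleCat.{0} R} (e : M) (he : ∀ r ∈ a ^ t, r • e = 0) :
    ∃ f : qM a t ⟶ M, f.hom (one' a t) = e := by
  refine ⟨ModuleCat.ofHom (Submodule.liftQ (a ^ t) (LinearMap.toSpanSingleton R M e) ?_), ?_⟩
  · intro r hr; exact he r hr
  · exact one_smul R e

def RepLC (a : Ideal R) (i : ℕ) (e : I.cocomplex.X i) (y : (localCohomology a i).obj X) : Prop :=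
  ∃ (t : ℕ) (h : qM a t ⟶ I.cocomplex.X i) (y0 : oldExt i (qM a t) X),
    ER I (qM a t) y0 h ∧ h.hom (one' a t) = e ∧ (iot a i X t).hom y0 = y

variable {I} {a : Ideal R} {i : ℕ}

lemma Rep_exists (y : (localCohomology a i).obj X) : ∃ e, RepLC I a i e y := by
  obtain ⟨t, y0, h⟩ := iot_surj a i X y
  obtain ⟨f, hf⟩ := ER_exists_h I y0
  exact ⟨_, t, f, y0, hf, rfl, h⟩

lemma Rep_smul {e : I.cocomplex.X i} {y} (r : R) (H : RepLC I a i e y) : RepLC I a i (r • e) (r • y) := by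
  obtain ⟨t, h, y0, H, rfl, rfl⟩ := H
  exact ⟨t, r • h, r • y0, ER_smul I r H, rfl, map_smul _ _ _⟩

lemma Rep_up {t s : ℕ} (hs : t ≤ s) {h : qM a t ⟶ I.cocomplex.X i} {y0 : oldExt i (qM a t) X}
    (H : ER I (qM a t) y0 h) : ER I (qM a s) ((transM a i X hs).hom y0) (qT a hs ≫ h) ∧
      (qT a hs ≫ h).hom (one' a s) = h.hom (one' a t) ∧
      (iot a i X s).hom ((transM a i X hs).hom y0) = (iot a i X t).hom y0 := by
  refine ⟨ER_map I _ H, ?_, ?_⟩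
  · exact congrArg h.hom (qT_one a hs)
  · exact congrArg (fun u => u.hom y0) (iot_w a i X hs)

lemma Rep_sub {e e' : I.cocomplex.X i} {y y'} (H : RepLC I a i e y) (H' : RepLC I a i e' y') :
    RepLC I a i (e - e') (y - y') := by
  obtain ⟨t, h, y0, H, rfl, rfl⟩ := H
  obtain ⟨t', h', y0', H', rfl, rfl⟩ := H'
  obtain ⟨A, B, C⟩ := Rep_up (le_max_left t t') H
  obtain ⟨A', B', C'⟩ := Rep_up (le_max_right t t') H'
  refine ⟨_, _, _, ER_sub I A A', ?_, ?_⟩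
  · rw [← B, ← B']; rfl
  · rw [map_sub, C, C']

def Gam (a : Ideal R) {M : ModuleCat.{0} R} (e : M) : Prop := ∃ t : ℕ, ∀ r ∈ a ^ t, r • e = 0

lemma Rep_cocycle {e : I.cocomplex.X i} {y} (H : RepLC I a i e y) :
    (I.cocomplex.d i (i+1)).hom e = 0 ∧ Gam a e := by
  obtain ⟨t, h, y0, H, rfl, rfl⟩ := H
  exact ⟨congrArg (fun u => u.hom (one' a t)) H.1, t, q_ann h⟩

lemma Rep_of_cocycle {e : I.cocomplex.X i} (h : (I.cocomplex.d i (i+1)).hom e = 0) (h' : Gam a e) :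
    ∃ y, RepLC I a i e y := by
  obtain ⟨t, ht⟩ := h'
  obtain ⟨f, hf⟩ := q_lift e ht
  obtain ⟨y0, H⟩ := ER_exists_y I f (by
    apply q_ext
    change (I.cocomplex.d i (i+1)).hom (f.hom _) = 0
    rw [hf, h])
  exact ⟨_, t, f, y0, H, hf, rfl⟩

lemma Rep_zero_zero {e : I.cocomplex.X 0} {y} (H : RepLC I a 0 e y) : y = 0 ↔ e = 0 := by
  obtain ⟨t, h, y0, H, rfl, rfl⟩ := H
  constructor
  · intro h0
    obtain ⟨s, hs, e⟩ := iot_zero _ _ _ _ _ h0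
    obtain ⟨A, B, C⟩ := Rep_up hs H
    rw [ER_zero_iff_zero I A] at e
    rw [← B, e]; rfl
  · intro h0
    have : h = 0 := q_ext h0
    rw [← ER_zero_iff_zero I H] at this
    rw [this, map_zero]

lemma Rep_zero_succ {e : I.cocomplex.X (i+1)} {y} (H : RepLC I a (i+1) e y) :
    y = 0 ↔ ∃ w : I.cocomplex.X i, Gam a w ∧ (I.cocomplex.d i (i+1)).hom w = e := by
  obtain ⟨t, h, y0, H, rfl, rfl⟩ := H
  constructor
  · intro h0
    obtain ⟨s, hs, e⟩ := iot_zero _ _ _ _ _ h0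
    obtain ⟨A, B, C⟩ := Rep_up hs H
    rw [ER_zero_iff_succ I A] at e
    obtain ⟨g, hg⟩ := e
    refine ⟨g.hom (one' a s), ⟨s, q_ann g⟩, ?_⟩
    rw [← B, ← hg]; rfl
  · rintro ⟨w, ⟨s, hs⟩, hw⟩
    obtain ⟨A, B, C⟩ := Rep_up (le_max_left t s) H
    obtain ⟨g, hg⟩ := q_lift (a := a) (t := max t s) w (fun r hr => hs r (Ideal.pow_le_pow_right (le_max_right _ _) hr))
    have : (transM a (i+1) X (le_max_left t s)).hom y0 = 0 := by
      rw [ER_zero_iff_succ I A]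
      refine ⟨g, q_ext ?_⟩
      rw [B, ← hw, ← hg]; rfl
    rw [← C, this, map_zero]

lemma Rep_unique {e : I.cocomplex.X i} {y y'} (H : RepLC I a i e y) (H' : RepLC I a i e y') : y = y' := by
  have h := Rep_sub H H'
  rw [sub_self] at h
  rw [← sub_eq_zero]
  rcases i with _ | i
  · exact (Rep_zero_zero h).2 rfl
  · exact (Rep_zero_succ h).2 ⟨0, ⟨0, by simp⟩, map_zero _⟩

lemma Rep_add {e e' : I.cocomplex.X i} {y y'} (H : RepLC I a i e y) (H' : RepLC I a i e' y') :
    RepLC I a i (e + e') (y + y') := by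
  have := Rep_sub H (Rep_smul (-1) H')
  simpa using this
end rep
section alg
variable {R : Type} [CommRing R]

lemma sup_kill {a : Ideal R} {x : R} {M : ModuleCat.{0} R} {e : M} :
    Gam (a ⊔ Ideal.span {x}) e ↔ Gam a e ∧ ∃ k : ℕ, x ^ k • e = 0 := by
  constructor
  · rintro ⟨t, ht⟩
    refine ⟨⟨t, fun r hr => ht r (Ideal.pow_right_mono le_sup_left t hr)⟩, t, ht _ ?_⟩
    exact Ideal.pow_mem_pow (Ideal.mem_sup_right (Ideal.mem_span_singleton_self x)) t
  · rintro ⟨⟨t, ht⟩, k, hk⟩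
    refine ⟨t + k, fun r hr => ?_⟩
    have h1 : (a ⊔ Ideal.span {x}) ^ (t + k) ≤ a ^ t ⊔ Ideal.span {x} ^ k := Ideal.sup_pow_add_le_pow_sup_pow
    obtain ⟨u, hu, v, hv, rfl⟩ := Submodule.mem_sup.1 (h1 hr)
    rw [Ideal.span_singleton_pow, Ideal.mem_span_singleton'] at hv
    obtain ⟨c, rfl⟩ := hv
    rw [add_smul, ht u hu, mul_smul, hk, smul_zero, add_zero]

lemma Gam_sub {a : Ideal R} {M : ModuleCat.{0} R} {e e' : M} (h : Gam a e) (h' : Gam a e') : Gam a (e - e') := by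
  obtain ⟨t, ht⟩ := h
  obtain ⟨t', ht'⟩ := h'
  refine ⟨max t t', fun r hr => ?_⟩
  rw [smul_sub, ht r (Ideal.pow_le_pow_right (le_max_left _ _) hr), ht' r (Ideal.pow_le_pow_right (le_max_right _ _) hr), sub_zero]

lemma Gam_smul {a : Ideal R} {M : ModuleCat.{0} R} {e : M} (c : R) (h : Gam a e) : Gam a (c • e) := by
  obtain ⟨t, ht⟩ := h
  exact ⟨t, fun r hr => by rw [smul_comm, ht r hr, smul_zero]⟩

lemma Gam_map {a : Ideal R} {M N : ModuleCat.{0} R} {e : M} (f : M ⟶ N) (h : Gam a e) : Gam a (f.hom e) := by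
  obtain ⟨t, ht⟩ := h
  exact ⟨t, fun r hr => by rw [← map_smul, ht r hr, map_zero]⟩

lemma colon_stab [IsNoetherianRing R] (b : Ideal R) (x : R) : ∃ m : ℕ, ∀ k r, x ^ (m + k) * r ∈ b → x ^ m * r ∈ b := by
  let f : ℕ →o Ideal R :=
    ⟨fun m => Submodule.comap (LinearMap.mulLeft R (x ^ m)) b, by
      intro m n hmn r hr
      obtain ⟨k, rfl⟩ := Nat.exists_eq_add_of_le hmn
      change x ^ (m + k) * r ∈ b
      rw [add_comm, pow_add, mul_assoc]
      exact b.mul_mem_left _ hr⟩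
  obtain ⟨m, hm⟩ := monotone_stabilizes_iff_noetherian.2 (inferInstanceAs (IsNoetherian R R)) f
  refine ⟨m, fun k r hr => ?_⟩
  have : r ∈ f (m + k) := hr
  rw [← hm (m + k) (Nat.le_add_right _ _)] at this
  exact this

lemma inj_split [IsNoetherianRing R] (J : ModuleCat.{0} R) [Injective J] (b : Ideal R) (x : R) (w : J)
    (hw : ∀ r ∈ b, r • w = 0) (k : ℕ) :
    ∃ w1 : J, (∀ r ∈ b, r • w1 = 0) ∧ ∃ m : ℕ, x ^ m • (w - x ^ k • w1) = 0 := by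
  obtain ⟨m, hm⟩ := colon_stab b x
  -- the map r ↦ x ^ (m + k) * r : R / (b : x ^ m) → R / b is injective
  let b' : Ideal R := Submodule.comap (LinearMap.mulLeft R (x ^ m)) b
  have hb' : ∀ r, r ∈ b' ↔ x ^ m * r ∈ b := fun r => Iff.rfl
  let g : (R ⧸ b') →ₗ[R] (R ⧸ b) := Submodule.mapQ b' b (LinearMap.mulLeft R (x ^ (m + k))) (by
    intro r hr
    change x ^ (m + k) * r ∈ b
    rw [add_comm, pow_add, mul_assoc]
    exact b.mul_mem_left _ hr)
  have hg : Function.Injective g := by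
    rw [← LinearMap.ker_eq_bot, LinearMap.ker_eq_bot']
    intro z hz
    obtain ⟨r, rfl⟩ := Submodule.Quotient.mk_surjective _ z
    rw [Submodule.Quotient.mk_eq_zero]
    have : (Submodule.Quotient.mk (x ^ (m + k) * r) : R ⧸ b) = 0 := hz
    rw [Submodule.Quotient.mk_eq_zero] at this
    exact hm _ _ this
  let p : (R ⧸ b') →ₗ[R] J := Submodule.liftQ b' (LinearMap.toSpanSingleton R J (x ^ m • w)) (by
    intro r hr
    change r • x ^ m • w = 0
    rw [smul_smul, mul_comm]
    exact hw _ hr)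
  have : Mono (ModuleCat.ofHom g) := (ModuleCat.mono_iff_injective _).2 hg
  let q := Injective.factorThru (ModuleCat.ofHom p) (ModuleCat.ofHom g)
  have hq : ModuleCat.ofHom g ≫ q = ModuleCat.ofHom p := Injective.comp_factorThru _ _
  have hq1 := congrArg (fun u => u.hom (Submodule.Quotient.mk 1 : R ⧸ b')) hq
  have e1 : q.hom (Submodule.Quotient.mk (x ^ (m + k) * 1) : R ⧸ b) = (1 : R) • x ^ m • w := hq1
  have e2 : ∀ r : R, q.hom (Submodule.Quotient.mk r : R ⧸ b) = r • q.hom (Submodule.Quotient.mk 1 : R ⧸ b) := by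
    intro r
    rw [← map_smul]
    congr 1
    change _ = Submodule.Quotient.mk (r • 1)
    simp
  refine ⟨q.hom (Submodule.Quotient.mk 1 : R ⧸ b), ?_, m, ?_⟩
  · intro r hr
    rw [← e2, (Submodule.Quotient.mk_eq_zero b).2 hr]
    exact map_zero _
  · rw [mul_one, one_smul, e2] at e1
    rw [smul_sub, smul_smul, ← pow_add, e1, sub_self]

lemma gam_split [IsNoetherianRing R] (J : ModuleCat.{0} R) [Injective J] (a : Ideal R) (x : R) (w : J)
    (hw : Gam a w) (k : ℕ) :
    ∃ w1 : J, Gam a w1 ∧ Gam (a ⊔ Ideal.span {x}) (w - x ^ k • w1) := by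
  obtain ⟨t, ht⟩ := hw
  obtain ⟨w1, h1, m, hm⟩ := inj_split J (a ^ t) x w ht k
  exact ⟨w1, ⟨t, h1⟩, sup_kill.2 ⟨Gam_sub ⟨t, ht⟩ (Gam_smul _ ⟨t, h1⟩), m, hm⟩⟩
end alg

section key
variable {R : Type} [CommRing R] {X : ModuleCat.{0} R} (I : InjectiveResolution X)

def Zc (a : Ideal R) (i : ℕ) : Submodule R (I.cocomplex.X i) where
  carrier := {e | (I.cocomplex.d i (i+1)).hom e = 0 ∧ Gam a e}
  add_mem' := by
    rintro e e' ⟨h1, h2⟩ ⟨h3, h4⟩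
    refine ⟨by rw [map_add, h1, h3, add_zero], ?_⟩
    have := Gam_sub h2 (Gam_smul (-1) h4)
    simpa using this
  zero_mem' := ⟨map_zero _, 0, by simp⟩
  smul_mem' := by
    rintro c e ⟨h1, h2⟩
    exact ⟨by rw [map_smul, h1, smul_zero], Gam_smul c h2⟩

lemma mem_Zc (a : Ideal R) (i : ℕ) (e : I.cocomplex.X i) :
    e ∈ Zc I a i ↔ (I.cocomplex.d i (i+1)).hom e = 0 ∧ Gam a e := Iff.rfl

lemma exists_proj (a : Ideal R) (i : ℕ) : ∃ p : Zc I a i →ₗ[R] (localCohomology a i).obj X,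
    ∀ e, RepLC I a i e.1 (p e) := by
  choose f hf using fun e : Zc I a i => Rep_of_cocycle (I := I) e.2.1 e.2.2
  refine ⟨⟨⟨f, ?_⟩, ?_⟩, hf⟩
  · intro e e'
    exact Rep_unique (hf _) (Rep_add (hf e) (hf e'))
  · intro c e
    exact Rep_unique (hf _) (Rep_smul c (hf e))

lemma equiv_of_surj {A B C : Type} [AddCommGroup A] [AddCommGroup B] [AddCommGroup C] [Module R A] [Module R B]
    [Module R C] (f : A →ₗ[R] B) (g : A →ₗ[R] C) (hf : Function.Surjective f) (hg : Function.Surjective g)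
    (h : ∀ z, f z = 0 ↔ g z = 0) : Nonempty (B ≃ₗ[R] C) := by
  have hk : LinearMap.ker f = LinearMap.ker g := by ext z; exact h z
  exact ⟨(f.quotKerEquivOfSurjective hf).symm.trans ((Submodule.quotEquivOfEq _ _ hk).trans (g.quotKerEquivOfSurjective hg))⟩

lemma d_d (i : ℕ) (w : I.cocomplex.X i) :
    (I.cocomplex.d (i+1) (i+1+1)).hom ((I.cocomplex.d i (i+1)).hom w) = 0 :=
  congrArg (fun u => u.hom w) (I.cocomplex.d_comp_d i (i+1) (i+1+1))

/-- correct a Gam_a cochain whose multiple is a cocycle -/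
lemma correct [IsNoetherianRing R] (a : Ideal R) (x : R) (i : ℕ)
    (h : ∀ y : (localCohomology a i).obj X, ∃ k : ℕ, x ^ k • y = 0)
    (w : I.cocomplex.X i) (hw : Gam a w) (k : ℕ) (hk : x ^ k • (I.cocomplex.d i (i+1)).hom w = 0) :
    ∃ w' : I.cocomplex.X i, Gam (a ⊔ Ideal.span {x}) w' ∧
      (I.cocomplex.d i (i+1)).hom w' = (I.cocomplex.d i (i+1)).hom w ∧
      (∃ v, Gam a v ∧ (w = w' + v) ∧ ∀ y, RepLC I a i v y → y = 0) := by
  obtain ⟨y, hy⟩ := Rep_of_cocycle (I := I) (a := a) (e := x ^ k • w) (by rw [map_smul, hk]) (Gam_smul _ hw)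
  obtain ⟨l, hl⟩ := h y
  have hy2 := Rep_smul (x ^ l) hy
  rw [smul_smul, ← pow_add] at hy2
  rcases i with _ | i
  · rw [Rep_zero_zero hy2] at hl
    refine ⟨w, sup_kill.2 ⟨hw, _, hl⟩, rfl, 0, ⟨0, by simp⟩, by simp, fun y hy => (Rep_zero_zero hy).2 rfl⟩
  · rw [Rep_zero_succ hy2] at hl
    obtain ⟨v, hv, hdv⟩ := hl
    obtain ⟨v1, hv1, hv2⟩ := gam_split (I.cocomplex.X i) a x v hv (l + k)
    refine ⟨w - (I.cocomplex.d i (i+1)).hom v1, ?_, ?_, (I.cocomplex.d i (i+1)).hom v1, Gam_map _ hv1, by simp, ?_⟩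
    · obtain ⟨_, m, hm⟩ := sup_kill.1 hv2
      refine sup_kill.2 ⟨Gam_sub hw (Gam_map _ hv1), m + (l + k), ?_⟩
      have := congrArg (I.cocomplex.d i (i+1)).hom hm
      rw [map_smul, map_sub, map_smul, hdv, map_zero, ← smul_sub, smul_smul, ← pow_add] at this
      exact this
    · rw [map_sub, d_d, sub_zero]
    · intro y hy
      exact (Rep_zero_succ hy).2 ⟨v1, hv1, rfl⟩

lemma key_iso [IsNoetherianRing R] {X : ModuleCat.{0} R} (I : InjectiveResolution X) (a : Ideal R) (x : R) (i : ℕ)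
    (h : ∀ y : (localCohomology a i).obj X, ∃ k : ℕ, x ^ k • y = 0)
    (h' : ∀ y : (localCohomology a (i+1)).obj X, ∃ k : ℕ, x ^ k • y = 0) :
    Nonempty (((localCohomology (a ⊔ Ideal.span {x}) (i+1)).obj X) ≅ ((localCohomology a (i+1)).obj X)) := by
  obtain ⟨p, hp⟩ := exists_proj I (a ⊔ Ideal.span {x}) (i+1)
  obtain ⟨q, hq⟩ := exists_proj I a (i+1)
  have hle : Zc I (a ⊔ Ideal.span {x}) (i+1) ≤ Zc I a (i+1) := fun e he => ⟨he.1, (sup_kill.1 he.2).1⟩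
  have main := equiv_of_surj p (q.comp (Submodule.inclusion hle)) ?_ ?_ ?_
  · obtain ⟨E⟩ := main
    exact ⟨E.toModuleIso⟩
  · intro y
    obtain ⟨e, he⟩ := Rep_exists (I := I) y
    exact ⟨⟨e, Rep_cocycle he⟩, Rep_unique (hp _) he⟩
  · intro y
    obtain ⟨e, he⟩ := Rep_exists (I := I) y
    obtain ⟨hd, hG⟩ := Rep_cocycle he
    obtain ⟨e', h1, h2, v, hv, hev, h3⟩ := correct I a x (i+1) h' e hG 0 (by simp [hd])
    refine ⟨⟨e', by rw [h2, hd], h1⟩, ?_⟩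
    have r1 : RepLC I a (i+1) e' ((q.comp (Submodule.inclusion hle)) ⟨e', by rw [h2, hd], h1⟩) :=
      hq (Submodule.inclusion hle ⟨e', by rw [h2, hd], h1⟩)
    have r2 := Rep_sub he r1
    have : e - e' = v := by rw [hev]; simp
    rw [this] at r2
    exact (sub_eq_zero.1 (h3 _ r2)).symm
  · intro z
    have r1 := hp z
    have r2 : RepLC I a (i+1) z.1 ((q.comp (Submodule.inclusion hle)) z) := hq (Submodule.inclusion hle z)
    rw [Rep_zero_succ r1, Rep_zero_succ r2]
    constructor
    · rintro ⟨w, hw, hd⟩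
      exact ⟨w, (sup_kill.1 hw).1, hd⟩
    · rintro ⟨w, hw, hd⟩
      obtain ⟨_, k, hk⟩ := sup_kill.1 z.2.2
      obtain ⟨w', h1, h2, _⟩ := correct I a x i h w hw k (by rw [hd, hk])
      exact ⟨w', h1, h2.trans hd⟩

lemma torsion_iso {b : Ideal R} {M N : ModuleCat.{0} R} (e : M ≅ N) (h : IsTorsionWrt b N) : IsTorsionWrt b M := by
  intro y
  obtain ⟨k, hk⟩ := h (e.hom.hom y)
  refine ⟨k, fun r hr => ?_⟩
  have := hk r hr
  rw [← map_smul] at this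
  have h2 := congrArg e.inv.hom this
  rw [map_zero] at h2
  rw [← h2]
  exact (congrArg (fun u => u.hom (r • y)) e.hom_inv_id).symm

lemma induct [IsNoetherianRing R] (X : ModuleCat.{0} R) (b : Ideal R) (s : ℕ) : ∀ (a : Ideal R) (n : ℕ) (f : Fin s → R),
    (∀ j, f j ∈ b.radical) →
    (∀ i, n ≤ i → IsTorsionWrt b ((localCohomology a i).obj X)) →
    ∀ i, n + s ≤ i → Nonempty ((localCohomology a i).obj X ≅ (localCohomology (a ⊔ Ideal.span (Set.range f)) i).obj X) := by
  induction s with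
  | zero =>
    intro a n f hf h i hi
    have : a ⊔ Ideal.span (Set.range f) = a := by simp
    rw [this]
    exact ⟨Iso.refl _⟩
  | succ s ih =>
    intro a n f hf h i hi
    have tor : ∀ i, n ≤ i → ∀ y : (localCohomology a i).obj X, ∃ k : ℕ, f 0 ^ k • y = 0 := by
      intro i hi y
      obtain ⟨k, hk⟩ := h i hi y
      obtain ⟨m, hm⟩ := hf 0
      refine ⟨m * k, hk _ ?_⟩
      rw [pow_mul]
      exact Ideal.pow_mem_pow hm k
    have key : ∀ i, n + 1 ≤ i → Nonempty ((localCohomology (a ⊔ Ideal.span {f 0}) i).obj X ≅ (localCohomology a i).obj X) := by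
      intro i hi
      obtain ⟨j, rfl⟩ : ∃ j, i = j + 1 := ⟨i - 1, by omega⟩
      exact key_iso (injectiveResolution X) a (f 0) j (tor j (by omega)) (tor (j+1) (by omega))
    obtain ⟨e1⟩ := key i (by omega)
    obtain ⟨e2⟩ := ih (a ⊔ Ideal.span {f 0}) (n + 1) (fun j => f j.succ) (fun j => hf _)
      (fun i hi => by
        obtain ⟨e⟩ := key i hi
        exact torsion_iso e (h i (by omega))) i (by omega)
    have : a ⊔ Ideal.span (Set.range f) = a ⊔ Ideal.span {f 0} ⊔ Ideal.span (Set.range fun j => f (Fin.succ j)) := by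
      rw [sup_assoc, ← Ideal.span_union]
      congr 2
      ext z
      simp [Fin.exists_fin_succ, eq_comm]
    rw [this]
    exact ⟨e1.symm ≪≫ e2⟩
end key
end localCohomologyProof

/-- Let `R` be a commutative noetherian ring, `a ⊆ b` ideals of `R`, `X` an
arbitrary `R`-module and `n ≥ 0`.  If `H^i_a(X)` is `b`-torsion for all `i ≥ n`, then
`H^i_a(X) ≅ H^i_b(X)` for all `i ≥ n + ara(b/a)`. -/
theorem statement11 {R : Type} [CommRing R] [IsNoetherianRing R] (a b : Ideal R) (hab : a ≤ b)
    (X : ModuleCat R) (n : ℕ)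
    (h : ∀ i, n ≤ i → IsTorsionWrt b ((localCohomology a i).obj X)) :
    ∀ i, n + araRankRel a b ≤ i →
      Nonempty ((localCohomology a i).obj X ≅ (localCohomology b i).obj X) := by
  intro i hi
  have hne : {n : ℕ | ∃ f : Fin n → R, (Ideal.span (Set.range f) + a).radical = b.radical}.Nonempty := by
    obtain ⟨m, f, hf⟩ := Submodule.fg_iff_exists_fin_generating_family.1 (IsNoetherian.noetherian b)
    refine ⟨m, f, ?_⟩
    have : Ideal.span (Set.range f) = b := hf
    rw [this, Submodule.add_eq_sup, sup_eq_left.2 hab]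
  obtain ⟨f, hf⟩ := Nat.sInf_mem hne
  obtain ⟨e⟩ := induct X b _ a n f (fun j => by
    rw [← hf]
    exact Ideal.le_radical (Ideal.mem_sup_left (Ideal.subset_span ⟨j, rfl⟩))) h i hi
  have hr : (a ⊔ Ideal.span (Set.range f)).radical = b.radical := by
    rw [sup_comm]; exact hf
  exact ⟨e ≪≫ (localCohomology.isoOfSameRadical hr i).app X⟩
end

section
/- Let R be a commutative noetherian ring, let a ⊆ b be ideals of R, let M be a finitely generated R-module, and let n be a non-negative integer. If H^i_a(M) is b-torsion for all i ≥ n, then H^i_a(M) ≅ H^i_b(M) for all i ≥ n + cd(b/a, M). -/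
open CategoryTheory

/-- The cohomological dimension `cd(a, X) = sup {i | H^i_a(X) ≠ 0}` of an `R`-module `X`
with respect to an ideal `a`. -/
noncomputable def cohDim {R : Type} [CommRing R] (a : Ideal R) (X : ModuleCat R) : ℕ :=
  sSup {i : ℕ | Nontrivial ((localCohomology a i).obj X)}

/-- For ideals `a ⊆ b`, the relative cohomological dimension
`cd(b/a, X) = inf {cd(c, X) | c an ideal of R with √b = √(c + a)}`. -/
noncomputable def cohDimRel {R : Type} [CommRing R] (a b : Ideal R) (X : ModuleCat R) : ℕ :=
  sInf {m : ℕ | ∃ c : Ideal R, b.radical = (c + a).radical ∧ cohDim c X = m}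


open CategoryTheory

namespace LC
open Limits Opposite

section comparison
variable {R : Type} [CommRing R]

/-- cocycles in `Hom(P, Y)` -/
def coc {X : ModuleCat.{0} R} (P : ProjectiveResolution X) (Y : ModuleCat.{0} R) (n : ℕ) :
    Submodule R (P.complex.X n ⟶ Y) where
  carrier := {f | P.complex.d (n+1) n ≫ f = 0}
  add_mem' := by
    intro f g hf hg
    simp only [Set.mem_ofPred_eq] at *
    rw [Preadditive.comp_add, hf, hg, add_zero]
  zero_mem' := by simp
  smul_mem' := by
    intro r f hf
    simp only [Set.mem_ofPred_eq] at *
    rw [Linear.comp_smul, hf, smul_zero]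

noncomputable def clsCyc {X : ModuleCat.{0} R} (P : ProjectiveResolution X) (Y : ModuleCat.{0} R)
    (n : ℕ) : ModuleCat.of R (coc P Y n) ⟶ (P.complex.linearYonedaObj R Y).cycles n :=
  (P.complex.linearYonedaObj R Y).liftCycles (ModuleCat.ofHom (coc P Y n).subtype) (n+1)
    (by simp) (by
      ext f
      exact f.2)

lemma clsCyc_i {X : ModuleCat.{0} R} (P : ProjectiveResolution X) (Y : ModuleCat.{0} R)
    (n : ℕ) : clsCyc P Y n ≫ (P.complex.linearYonedaObj R Y).iCycles n =
      ModuleCat.ofHom (coc P Y n).subtype := by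
  exact HomologicalComplex.liftCycles_i _ _ _ _ _

lemma clsCyc_surj {X : ModuleCat.{0} R} (P : ProjectiveResolution X) (Y : ModuleCat.{0} R)
    (n : ℕ) : Function.Surjective (clsCyc P Y n).hom := by
  intro z
  let K := P.complex.linearYonedaObj R Y
  let f : P.complex.X n ⟶ Y := (K.iCycles n).hom z
  have hf : f ∈ coc P Y n := by
    have := K.iCycles_d n (n+1)
    have := congrArg (fun φ => φ.hom z) this
    exact this
  refine ⟨⟨f, hf⟩, ?_⟩
  have hm : Function.Injective (K.iCycles n).hom := by
    rw [← ModuleCat.mono_iff_injective]; infer_instance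
  apply hm
  exact congrArg (fun φ => φ.hom (⟨f, hf⟩ : coc P Y n)) (clsCyc_i P Y n)

noncomputable def cls {X : ModuleCat.{0} R} (P : ProjectiveResolution X) (Y : ModuleCat.{0} R)
    (n : ℕ) : ModuleCat.of R (coc P Y n) ⟶ ((Ext R (ModuleCat.{0} R) n).obj (op X)).obj Y :=
  clsCyc P Y n ≫ (P.complex.linearYonedaObj R Y).homologyπ n ≫ (P.isoExt n Y).inv

lemma cls_surj {X : ModuleCat.{0} R} (P : ProjectiveResolution X) (Y : ModuleCat.{0} R)
    (n : ℕ) : Function.Surjective (cls P Y n).hom := by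
  have h1 : Function.Surjective ((P.complex.linearYonedaObj R Y).homologyπ n ≫ (P.isoExt n Y).inv).hom := by
    rw [← ModuleCat.epi_iff_surjective]; infer_instance
  exact h1.comp (clsCyc_surj P Y n)

lemma cls_eq_zero {X : ModuleCat.{0} R} (P : ProjectiveResolution X) (Y : ModuleCat.{0} R)
    (n : ℕ) (f : coc P Y n) : (cls P Y n).hom f = 0 ↔
      ∃ g, ((P.complex.linearYonedaObj R Y).d ((ComplexShape.up ℕ).prev n) n).hom g = f.1 := by
  let K := P.complex.linearYonedaObj R Y
  have hm : Function.Injective (K.iCycles n).hom := by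
    rw [← ModuleCat.mono_iff_injective]; infer_instance
  have hm' : Function.Injective (P.isoExt (R := R) n Y).inv.hom := by
    rw [← ModuleCat.mono_iff_injective]; infer_instance
  have hi : (K.iCycles n).hom ((clsCyc P Y n).hom f) = f.1 :=
    congrArg (fun φ => φ.hom f) (clsCyc_i P Y n)
  have hex : (ShortComplex.mk (K.toCycles ((ComplexShape.up ℕ).prev n) n) (K.homologyπ n)
      (by simp)).Exact := 
    ShortComplex.exact_of_g_is_cokernel _ (K.homologyIsCokernel _ n rfl)
  rw [ShortComplex.moduleCat_exact_iff] at hex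
  have e1 : (cls P Y n).hom f = (P.isoExt n Y).inv.hom ((K.homologyπ n).hom ((clsCyc P Y n).hom f)) := rfl
  rw [e1]
  constructor
  · intro h
    have h2 : (K.homologyπ n).hom ((clsCyc P Y n).hom f) = 0 := hm' (by rw [h, map_zero])
    obtain ⟨g, hg⟩ := hex _ h2
    refine ⟨g, ?_⟩
    rw [← hi, ← K.toCycles_i]
    exact congrArg _ hg
  · rintro ⟨g, hg⟩
    have : (clsCyc P Y n).hom f = (K.toCycles _ n).hom g := by
      apply hm
      rw [hi, ← hg, ← K.toCycles_i]; rfl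
    rw [this]
    have h3 := congrArg (fun φ => φ.hom g) (K.toCycles_comp_homologyπ ((ComplexShape.up ℕ).prev n) n)
    have h4 : (K.homologyπ n).hom ((K.toCycles ((ComplexShape.up ℕ).prev n) n).hom g) = 0 := h3
    rw [h4, map_zero]

lemma cls_eq_zero_succ {X : ModuleCat.{0} R} (P : ProjectiveResolution X) (Y : ModuleCat.{0} R)
    (n : ℕ) (f : coc P Y (n+1)) : (cls P Y (n+1)).hom f = 0 ↔
      ∃ g : P.complex.X n ⟶ Y, P.complex.d (n+1) n ≫ g = f.1 := by
  rw [cls_eq_zero]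
  have : (ComplexShape.up ℕ).prev (n+1) = n := by simp
  rw [this]
  rfl

lemma cls_eq_zero_zero {X : ModuleCat.{0} R} (P : ProjectiveResolution X) (Y : ModuleCat.{0} R)
    (f : coc P Y 0) : (cls P Y 0).hom f = 0 ↔ f.1 = 0 := by
  rw [cls_eq_zero]
  have : (P.complex.linearYonedaObj R Y).d ((ComplexShape.up ℕ).prev 0) 0 = 0 := by
    apply HomologicalComplex.shape
    simp
  rw [this]
  constructor
  · rintro ⟨g, hg⟩; rw [← hg]; rfl
  · intro h; exact ⟨0, by rw [h]; rfl⟩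

noncomputable def yoMap {X X' : ModuleCat.{0} R} (P : ProjectiveResolution X) (P' : ProjectiveResolution X')
    (Y : ModuleCat.{0} R) (φ : P'.complex ⟶ P.complex) :
    P.complex.linearYonedaObj R Y ⟶ P'.complex.linearYonedaObj R Y :=
  ((HomologicalComplex.unopFunctor _ _).map
    ((((linearYoneda R (ModuleCat.{0} R)).obj Y).rightOp.mapHomologicalComplex _).map φ).op)

lemma isoExt_inv_nat {X X' : ModuleCat.{0} R} (P : ProjectiveResolution X)
    (P' : ProjectiveResolution X')
    (Y : ModuleCat.{0} R) (n : ℕ) (u : X' ⟶ X) (φ : ProjectiveResolution.Hom P' P u) :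
    (P.isoExt (R := R) n Y).inv ≫ ((Ext R (ModuleCat.{0} R) n).map u.op).app Y =
      HomologicalComplex.homologyMap (yoMap P P' Y φ.hom) n ≫ (P'.isoExt n Y).inv := by
  let F := ((linearYoneda R (ModuleCat.{0} R)).obj Y).rightOp
  have nat := ProjectiveResolution.isoLeftDerivedObj_hom_naturality u P' P φ.hom
    (by simpa using φ.hom_f_zero_comp_π_f_zero) F n
  have nat' := congrArg Quiver.Hom.unop nat
  have h2 := congrArg Quiver.Hom.unop (HomologicalComplex.homologyOp_hom_naturality
    (yoMap P P' Y φ.hom) n)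
  refine ModuleCat.hom_ext (LinearMap.ext fun x => ?_)
  have h3 := congrArg (fun ψ => ψ.hom
    (((P.complex.linearYonedaObj R Y).homologyOp n).hom.unop.hom x)) nat'
  have h4 := congrArg (fun ψ => (P'.isoLeftDerivedObj F n).hom.unop.hom (ψ.hom x)) h2
  exact h3.trans h4

lemma cls_nat {X X' : ModuleCat.{0} R} (P : ProjectiveResolution X) (P' : ProjectiveResolution X')
    (Y : ModuleCat.{0} R) (n : ℕ) (u : X' ⟶ X) (φ : ProjectiveResolution.Hom P' P u)
    (f : coc P Y n) (hf : φ.hom.f n ≫ f.1 ∈ coc P' Y n) :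
    (((Ext R (ModuleCat.{0} R) n).map u.op).app Y).hom ((cls P Y n).hom f) =
      (cls P' Y n).hom ⟨φ.hom.f n ≫ f.1, hf⟩ := by
  have h1 := congrArg (fun ψ => ψ.hom (((P.complex.linearYonedaObj R Y).homologyπ n).hom
    ((clsCyc P Y n).hom f))) (isoExt_inv_nat P P' Y n u φ)
  refine h1.trans ?_
  have h2 := congrArg (fun ψ => ψ.hom ((clsCyc P Y n).hom f))
    (HomologicalComplex.homologyπ_naturality (yoMap P P' Y φ.hom) n)
  refine (congrArg (P'.isoExt (R := R) n Y).inv.hom h2).trans ?_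
  have h3 : (HomologicalComplex.cyclesMap (yoMap P P' Y φ.hom) n).hom ((clsCyc P Y n).hom f) =
      (clsCyc P' Y n).hom ⟨φ.hom.f n ≫ f.1, hf⟩ := by
    have hm : Function.Injective ((P'.complex.linearYonedaObj R Y).iCycles n).hom := by
      rw [← ModuleCat.mono_iff_injective]; infer_instance
    apply hm
    have h4 := congrArg (fun ψ => ψ.hom ((clsCyc P Y n).hom f))
      (HomologicalComplex.cyclesMap_i (yoMap P P' Y φ.hom) n)
    refine h4.trans ?_
    have h5 := congrArg (fun ψ => ψ.hom (⟨φ.hom.f n ≫ f.1, hf⟩ : coc P' Y n)) (clsCyc_i P' Y n)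
    refine Eq.trans ?_ h5.symm
    have h6 := congrArg (fun ψ => ψ.hom f) (clsCyc_i P Y n)
    exact congrArg ((yoMap P P' Y φ.hom).f n).hom h6
  exact congrArg (fun z => (P'.isoExt (R := R) n Y).inv.hom
    (((P'.complex.linearYonedaObj R Y).homologyπ n).hom z)) h3
end comparison
end LC

open CategoryTheory

namespace LC
open Limits Opposite

section comparison2
variable {R : Type} [CommRing R]

lemma pextMk_zero_iff {X Y : ModuleCat.{0} R} (P : ProjectiveResolution X)
    (f : P.complex.X 0 ⟶ Y) (hf : P.complex.d 1 0 ≫ f = 0) :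
    P.extMk f 1 rfl hf = 0 ↔ f = 0 := by
  constructor
  · intro h
    rw [← P.extEquivCohomologyClass.apply_eq_iff_eq,
      ProjectiveResolution.extEquivCohomologyClass_extMk,
      ProjectiveResolution.extEquivCohomologyClass_zero,
      CochainComplex.HomComplex.CohomologyClass.mk_eq_zero_iff] at h
    rw [CochainComplex.HomComplex.Cocycle.toSingleMk_mem_coboundaries_iff _ _ _ _ _ 1 (by lia)] at h
    obtain ⟨g, hg⟩ := h
    have hz : IsZero (P.cochainComplex.X 1) := 
      P.cochainComplex.isZero_of_isStrictlyLE 0 1 (by lia)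
    rw [hz.eq_of_src g 0, comp_zero] at hg
    simpa using congrArg (fun z => (P.cochainComplexXIso (-(0:ℕ)) 0 rfl).inv ≫ z) hg.symm
  · rintro rfl; simp

lemma iextMk_zero_iff {X Y : ModuleCat.{0} R} (I : InjectiveResolution Y)
    (f : X ⟶ I.cocomplex.X 0) (hf : f ≫ I.cocomplex.d 0 1 = 0) :
    I.extMk f 1 rfl hf = 0 ↔ f = 0 := by
  constructor
  · intro h
    rw [← I.extEquivCohomologyClass.apply_eq_iff_eq,
      InjectiveResolution.extEquivCohomologyClass_extMk,
      InjectiveResolution.extEquivCohomologyClass_zero,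
      CochainComplex.HomComplex.CohomologyClass.mk_eq_zero_iff] at h
    rw [CochainComplex.HomComplex.Cocycle.fromSingleMk_mem_coboundaries_iff _ _ _ _ _ (-1) (by lia)] at h
    obtain ⟨g, hg⟩ := h
    have hz : IsZero (I.cochainComplex.X (-1)) := 
      I.cochainComplex.isZero_of_isStrictlyGE 0 (-1) (by lia)
    rw [hz.eq_of_tgt g 0, zero_comp] at hg
    simpa using congrArg (fun z => z ≫ (I.cochainComplexXIso (0:ℕ) 0 rfl).hom) hg.symm
  · rintro rfl; simp

lemma coc_prop {X Y : ModuleCat.{0} R} {P : ProjectiveResolution X} {n : ℕ}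
    (f : coc P Y n) : P.complex.d (n+1) n ≫ f.1 = 0 := f.2

lemma cls_zero_iff_ext {X Y : ModuleCat.{0} R} (P : ProjectiveResolution X) (n : ℕ)
    (f : coc P Y n) : (cls P Y n).hom f = 0 ↔ P.extMk f.1 (n+1) rfl (coc_prop f) = 0 := by
  cases n with
  | zero => rw [cls_eq_zero_zero]; exact (pextMk_zero_iff P f.1 (coc_prop f)).symm
  | succ n => rw [cls_eq_zero_succ]; exact (P.extMk_eq_zero_iff f.1 _ rfl (coc_prop f) n rfl).symm

/-- the map from cocycles to the derived-category Ext -/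
noncomputable def pext {X : ModuleCat.{0} R} (P : ProjectiveResolution X) (Y : ModuleCat.{0} R)
    (n : ℕ) : coc P Y n →ₗ[R] Abelian.Ext X Y n where
  toFun f := P.extMk f.1 (n+1) rfl (coc_prop f)
  map_add' f g := (P.add_extMk _ _ _ rfl (coc_prop f) (coc_prop g)).symm
  map_smul' r f := by
    refine Eq.trans ?_ (Abelian.Ext.smul_eq_comp_mk₀ _ _).symm
    refine Eq.trans ?_ (P.extMk_comp_mk₀ f.1 _ rfl (coc_prop f) _).symm
    congr 1

lemma pext_surj {X : ModuleCat.{0} R} (P : ProjectiveResolution X) (Y : ModuleCat.{0} R)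
    (n : ℕ) : Function.Surjective (pext P Y n) := fun e => by
  obtain ⟨f, hf, h⟩ := P.extMk_surjective e (n+1) rfl
  exact ⟨⟨f, hf⟩, h⟩

lemma exists_al {X : ModuleCat.{0} R} (P : ProjectiveResolution X) (Y : ModuleCat.{0} R)
    (n : ℕ) : ∃ al : Abelian.Ext X Y n ≃ₗ[R] ((Ext R (ModuleCat.{0} R) n).obj (op X)).obj Y,
      ∀ f : coc P Y n, al (pext P Y n f) = (cls P Y n).hom f := by
  let e1 := (pext P Y n).quotKerEquivOfSurjective (pext_surj P Y n)
  let e2 := (cls P Y n).hom.quotKerEquivOfSurjective (cls_surj P Y n)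
  have hk : LinearMap.ker (pext P Y n) = LinearMap.ker (cls P Y n).hom := by
    ext f
    rw [LinearMap.mem_ker, LinearMap.mem_ker, cls_zero_iff_ext]; rfl
  refine ⟨e1.symm.trans ((Submodule.quotEquivOfEq _ _ hk).trans e2), fun f => ?_⟩
  have : e1.symm (pext P Y n f) = Submodule.Quotient.mk f := by
    rw [LinearEquiv.symm_apply_eq]; rfl
  rw [LinearEquiv.trans_apply, this]
  rfl

noncomputable def al (X : ModuleCat.{0} R) (Y : ModuleCat.{0} R) (n : ℕ) :
    Abelian.Ext X Y n ≃ₗ[R] ((Ext R (ModuleCat.{0} R) n).obj (op X)).obj Y :=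
  (exists_al (projectiveResolution X) Y n).choose

lemma al_spec (X : ModuleCat.{0} R) (Y : ModuleCat.{0} R) (n : ℕ)
    (f : coc (projectiveResolution X) Y n) :
    al X Y n (pext (projectiveResolution X) Y n f) = (cls (projectiveResolution X) Y n).hom f :=
  (exists_al (projectiveResolution X) Y n).choose_spec f

lemma al_nat {X X' : ModuleCat.{0} R} (Y : ModuleCat.{0} R) (n : ℕ) (u : X' ⟶ X)
    (e : Abelian.Ext X Y n) :
    (((Ext R (ModuleCat.{0} R) n).map u.op).app Y).hom (al X Y n e) =
      al X' Y n ((Abelian.Ext.mk₀ u).comp e (zero_add n)) := by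
  obtain ⟨f, rfl⟩ := pext_surj (projectiveResolution X) Y n e
  let φ : ProjectiveResolution.Hom (projectiveResolution X') (projectiveResolution X) u :=
    ⟨ProjectiveResolution.lift u _ _, by 
      rw [← HomologicalComplex.comp_f, ProjectiveResolution.lift_commutes, 
        HomologicalComplex.comp_f]⟩
  have hf : φ.hom.f n ≫ f.1 ∈ coc (projectiveResolution X') Y n := by
    have := f.2
    change _ ≫ _ ≫ _ = 0
    rw [← φ.hom.comm_assoc]
    have h2 : (projectiveResolution X).complex.d (n+1) n ≫ f.1 = 0 := f.2
    rw [h2, comp_zero]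
  rw [al_spec, cls_nat _ _ Y n u φ f hf, ← al_spec]
  congr 1
  exact (ProjectiveResolution.mk₀_comp_extMk f.1 (n+1) rfl (coc_prop f) φ).symm

end comparison2
end LC

open CategoryTheory

namespace LC
open Limits Opposite

section colim
variable {R : Type} [CommRing R]

abbrev Qt (c : Ideal R) (t : ℕ) : ModuleCat.{0} R := ModuleCat.of R (R ⧸ c ^ t)

/-- transition maps -/
def tr (c : Ideal R) {t s : ℕ} (h : t ≤ s) : Qt c s ⟶ Qt c t :=
  ModuleCat.ofHom (Submodule.mapQ _ _ LinearMap.id (Ideal.pow_le_pow_right h))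

noncomputable def lcCocone (a : Ideal R) (i : ℕ) (M : ModuleCat.{0} R) :
    Cocone (localCohomology.diagram (localCohomology.idealPowersDiagram a) i ⋙
      (evaluation _ _).obj M) :=
  ((evaluation _ _).obj M).mapCocone
    (colimit.cocone (localCohomology.diagram (localCohomology.idealPowersDiagram a) i))

noncomputable def lcColim (a : Ideal R) (i : ℕ) (M : ModuleCat.{0} R) :
    IsColimit (lcCocone a i M) :=
  isColimitOfPreserves ((evaluation _ _).obj M) (colimit.isColimit _)

noncomputable def lciHom (a : Ideal R) (i : ℕ) (M : ModuleCat.{0} R) (t : ℕ) :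
    ((Ext R (ModuleCat.{0} R) i).obj (op (Qt a t))).obj M ⟶ (localCohomology a i).obj M :=
  (lcCocone a i M).ι.app (op (op t))

lemma lciHom_tr (a : Ideal R) (i : ℕ) (M : ModuleCat.{0} R) {t s : ℕ} (h : t ≤ s) :
   ((Ext R (ModuleCat.{0} R) i).map (tr a h).op).app M ≫ lciHom a i M s = lciHom a i M t :=
  (lcCocone a i M).w (homOfLE h).op.op

noncomputable def lci (a : Ideal R) (i : ℕ) (M : ModuleCat.{0} R) (t : ℕ) :
    Abelian.Ext (Qt a t) M i →ₗ[R] (localCohomology a i).obj M :=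
  (lciHom a i M t).hom ∘ₗ (al (Qt a t) M i).toLinearMap

lemma lci_tr (a : Ideal R) (i : ℕ) (M : ModuleCat.{0} R) {t s : ℕ} (h : t ≤ s)
    (e : Abelian.Ext (Qt a t) M i) :
    lci a i M s ((Abelian.Ext.mk₀ (tr a h)).comp e (zero_add i)) = lci a i M t e := by
  have h1 := congrArg (fun ψ => ψ.hom (al (Qt a t) M i e)) (lciHom_tr a i M h)
  refine Eq.trans ?_ h1
  exact congrArg (lciHom a i M s).hom (al_nat M i (tr a h) e).symm

lemma lci_surj (a : Ideal R) (i : ℕ) (M : ModuleCat.{0} R) (x : (localCohomology a i).obj M) :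
    ∃ t e, lci a i M t e = x := by
  obtain ⟨j, y, hy⟩ := Concrete.isColimit_exists_rep _ (lcColim a i M) x
  refine ⟨j.unop.unop, (al _ M i).symm y, ?_⟩
  refine Eq.trans ?_ hy
  exact congrArg (lciHom a i M j.unop.unop).hom ((al _ M i).apply_symm_apply y)

lemma lci_zero (a : Ideal R) (i : ℕ) (M : ModuleCat.{0} R) (t : ℕ) 
    (e : Abelian.Ext (Qt a t) M i) : lci a i M t e = 0 ↔
      ∃ (s : ℕ) (h : t ≤ s), (Abelian.Ext.mk₀ (tr a h)).comp e (zero_add i) = 0 := by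
  constructor
  · intro h
    have h0 : lci a i M t e = lci a i M t 0 := by rw [h, map_zero]
    obtain ⟨k, f, g, hfg⟩ := Concrete.isColimit_exists_of_rep_eq _ (lcColim a i M)
      (i := op (op t)) (j := op (op t)) (al _ M i e) (al _ M i 0) h0
    have hts : t ≤ k.unop.unop := leOfHom f.unop.unop
    refine ⟨k.unop.unop, hts, ?_⟩
    apply (al (Qt a k.unop.unop) M i).injective
    have e1 := al_nat M i (tr a hts) e
    have e2 := al_nat M i (tr a hts) 0
    have := (e1.symm.trans hfg).trans e2
    rw [this]
    congr 1
    simp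
  · rintro ⟨s, h, hs⟩
    rw [← lci_tr a i M h e, hs, map_zero]
end colim
end LC

open CategoryTheory

namespace LC
open Limits Opposite

section vee
variable {R : Type} [CommRing R]

/-- the torsion submodule -/
def gam (c : Ideal R) (N : Type) [AddCommGroup N] [Module R N] : Submodule R N where
  carrier := {x | ∃ k : ℕ, ∀ r ∈ c ^ k, r • x = 0}
  add_mem' := by
    rintro x y ⟨k, hk⟩ ⟨l, hl⟩
    refine ⟨k + l, fun r hr => ?_⟩
    rw [smul_add, hk r (Ideal.pow_le_pow_right (by lia) hr), 
      hl r (Ideal.pow_le_pow_right (by lia) hr), add_zero]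
  zero_mem' := ⟨0, fun r _ => smul_zero r⟩
  smul_mem' := by
    rintro a x ⟨k, hk⟩
    exact ⟨k, fun r hr => by rw [smul_comm, hk r hr, smul_zero]⟩

lemma mem_gam {c : Ideal R} {N : Type} [AddCommGroup N] [Module R N] {x : N} :
    x ∈ gam c N ↔ ∃ k : ℕ, ∀ r ∈ c ^ k, r • x = 0 := Iff.rfl

/-- `H^p_c(N) = 0` -/
def V (c : Ideal R) (p : ℕ) (N : Type) [AddCommGroup N] [Module R N] : Prop :=
  ∀ (t : ℕ) (e : Abelian.Ext (Qt c t) (ModuleCat.of R N) p),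
    ∃ (s : ℕ) (h : t ≤ s), (Abelian.Ext.mk₀ (tr c h)).comp e (zero_add p) = 0

def qhom (c : Ideal R) (t : ℕ) {N : Type} [AddCommGroup N] [Module R N] (x : N)
    (hx : ∀ r ∈ c ^ t, r • x = 0) : Qt c t ⟶ ModuleCat.of R N :=
  ModuleCat.ofHom (Submodule.liftQ _ (LinearMap.toSpanSingleton R N x) (fun r hr => by
    simpa using hx r hr))

lemma qhom_one (c : Ideal R) (t : ℕ) {N : Type} [AddCommGroup N] [Module R N] (x : N)
    (hx : ∀ r ∈ c ^ t, r • x = 0) : (qhom c t x hx).hom (Ideal.Quotient.mk _ 1) = x := by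
  change (1 : R) • x = x
  simp

lemma Qt_ext {c : Ideal R} {t : ℕ} {N : ModuleCat.{0} R} {f g : Qt c t ⟶ N}
    (h : f.hom (Ideal.Quotient.mk _ 1) = g.hom (Ideal.Quotient.mk _ 1)) : f = g := by
  refine ModuleCat.hom_ext (LinearMap.ext fun x => ?_)
  obtain ⟨r, rfl⟩ := Ideal.Quotient.mk_surjective x
  have e : (Ideal.Quotient.mk (c^t) r) = r • (Ideal.Quotient.mk (c^t) 1) := by
    rw [← mul_one r, map_mul]; simp [Algebra.smul_def]
  have := congrArg (fun z => r • z) h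
  rw [e]
  exact ((f.hom.map_smul r _).trans this).trans (g.hom.map_smul r _).symm

lemma Qt_val {c : Ideal R} {t : ℕ} {N : ModuleCat.{0} R} (f : Qt c t ⟶ N) :
    ∀ r ∈ c ^ t, r • f.hom (Ideal.Quotient.mk _ 1) = 0 := by
  intro r hr
  refine (f.hom.map_smul r _).symm.trans ?_
  have : r • (Ideal.Quotient.mk (c^t) 1) = 0 := by
    have : r • (Ideal.Quotient.mk (c^t) 1) = Ideal.Quotient.mk (c^t) r := by simp [Algebra.smul_def]
    rw [this, Ideal.Quotient.eq_zero_iff_mem]; exact hr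
  exact (congrArg f.hom this).trans (map_zero _)

lemma tr_one (c : Ideal R) {t s : ℕ} (h : t ≤ s) :
    (tr c h).hom (Ideal.Quotient.mk _ 1) = Ideal.Quotient.mk _ 1 := rfl

lemma tr_tr (c : Ideal R) {t s u : ℕ} (h : t ≤ s) (h' : s ≤ u) :
    tr c h' ≫ tr c h = tr c (h.trans h') := Qt_ext rfl

lemma tr_trans_zero {c : Ideal R} {p : ℕ} {N : ModuleCat.{0} R} {t s u : ℕ} (h : t ≤ s) (h' : s ≤ u)
    (e : Abelian.Ext (Qt c t) N p)
    (he : (Abelian.Ext.mk₀ (tr c h')).comp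
      ((Abelian.Ext.mk₀ (tr c h)).comp e (zero_add p)) (zero_add p) = 0) :
    (Abelian.Ext.mk₀ (tr c (h.trans h'))).comp e (zero_add p) = 0 := by
  rw [← tr_tr, ← Abelian.Ext.mk₀_comp_mk₀_assoc]; exact he

lemma V_of_subsingleton (c : Ideal R) (p : ℕ) (N : Type) [AddCommGroup N] [Module R N]
    [Subsingleton N] : V c p N := fun t e => by
  refine ⟨t, le_rfl, ?_⟩
  have hz : IsZero (ModuleCat.of R N) := ModuleCat.isZero_of_subsingleton _
  rw [← Abelian.Ext.comp_mk₀_id e, hz.eq_of_src (𝟙 (ModuleCat.of R N)) 0]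
  simp

lemma V_of_injective (c : Ideal R) (p : ℕ) (hp : 1 ≤ p) (N : Type) [AddCommGroup N] [Module R N]
    (h : Module.Injective R N) : V c p N := fun t e => by
  refine ⟨t, le_rfl, ?_⟩
  obtain ⟨p, rfl⟩ : ∃ q, p = q + 1 := ⟨p - 1, by lia⟩
  have : Injective (ModuleCat.of R N) := Module.injective_object_of_injective_module R N
  rw [Abelian.Ext.eq_zero_of_injective e, Abelian.Ext.comp_zero]

variable {A B C : Type} [AddCommGroup A] [Module R A] [AddCommGroup B] [Module R B]
  [AddCommGroup C] [Module R C] 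

structure SES (f : A →ₗ[R] B) (g : B →ₗ[R] C) : Prop where
  inj : Function.Injective f
  ex : Function.Exact f g
  surj : Function.Surjective g

abbrev SES.sc {f : A →ₗ[R] B} {g : B →ₗ[R] C} (h : SES f g) : ShortComplex (ModuleCat.{0} R) :=
  ShortComplex.mk (ModuleCat.ofHom f) (ModuleCat.ofHom g)
    (ModuleCat.hom_ext (LinearMap.ext fun x => (h.ex (f x)).2 ⟨x, rfl⟩))

lemma SES.short {f : A →ₗ[R] B} {g : B →ₗ[R] C} (h : SES f g) : h.sc.ShortExact where
  exact := (ShortComplex.ShortExact.moduleCat_exact_iff_function_exact _).mpr h.ex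
  mono_f := (ModuleCat.mono_iff_injective _).2 h.inj
  epi_g := (ModuleCat.epi_iff_surjective _).2 h.surj

variable {f : A →ₗ[R] B} {g : B →ₗ[R] C}

lemma SES.V2 (h : SES f g) {c : Ideal R} {p : ℕ} (hA : V c p A) (hC : V c p C) : V c p B := by
  intro t e
  obtain ⟨s, hs, h1⟩ := hC t (e.comp (Abelian.Ext.mk₀ h.sc.g) (add_zero p))
  rw [← Abelian.Ext.comp_assoc_of_third_deg_zero] at h1
  obtain ⟨e', he'⟩ := Abelian.Ext.covariant_sequence_exact₂ _ h.short _ h1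
  obtain ⟨u, hu, h2⟩ := hA s e'
  refine ⟨u, hs.trans hu, tr_trans_zero hs hu e ?_⟩
  rw [← he', ← Abelian.Ext.comp_assoc_of_third_deg_zero, h2, Abelian.Ext.zero_comp]

lemma SES.V3 (h : SES f g) {c : Ideal R} {p : ℕ} (hB : V c p B) (hA : V c (p+1) A) : V c p C := by
  intro t e
  obtain ⟨s, hs, h1⟩ := hA t (e.comp h.short.extClass rfl)
  rw [← Abelian.Ext.comp_assoc _ _ _ (zero_add p) _ (by lia)] at h1
  obtain ⟨e', he'⟩ := Abelian.Ext.covariant_sequence_exact₃ _ h.short _ _ h1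
  obtain ⟨u, hu, h2⟩ := hB s e'
  refine ⟨u, hs.trans hu, tr_trans_zero hs hu e ?_⟩
  rw [← he', ← Abelian.Ext.comp_assoc_of_third_deg_zero, h2, Abelian.Ext.zero_comp]

lemma SES.V1 (h : SES f g) {c : Ideal R} {p : ℕ} (hC : V c p C) (hB : V c (p+1) B) : 
    V c (p+1) A := by
  intro t e
  obtain ⟨s, hs, h1⟩ := hB t (e.comp (Abelian.Ext.mk₀ h.sc.f) (add_zero _))
  rw [← Abelian.Ext.comp_assoc_of_third_deg_zero] at h1
  obtain ⟨e', he'⟩ := Abelian.Ext.covariant_sequence_exact₁ _ h.short _ h1 (n₀ := p) rfl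
  obtain ⟨u, hu, h2⟩ := hC s e'
  refine ⟨u, hs.trans hu, tr_trans_zero hs hu e ?_⟩
  rw [← he', ← Abelian.Ext.comp_assoc _ _ _ (zero_add p) _ (by lia), h2, Abelian.Ext.zero_comp]

lemma SES.gam_surj (h : SES f g) {c : Ideal R} (hA : V c 1 A) (z : C) (hz : z ∈ gam c C) :
    ∃ y ∈ gam c B, g y = z := by
  obtain ⟨t, ht⟩ := hz
  obtain ⟨s, hs, h1⟩ := hA t ((Abelian.Ext.mk₀ (qhom c t z ht)).comp h.short.extClass (zero_add 1))
  rw [Abelian.Ext.mk₀_comp_mk₀_assoc] at h1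
  obtain ⟨e', he'⟩ := Abelian.Ext.covariant_sequence_exact₃ _ h.short _ _ h1
  obtain ⟨φ, rfl⟩ := (Abelian.Ext.mk₀_bijective _ _).2 e'
  rw [Abelian.Ext.mk₀_comp_mk₀] at he'
  have h3 := (Abelian.Ext.mk₀_bijective _ _).1 he'
  refine ⟨φ.hom (Ideal.Quotient.mk _ 1), ⟨s, Qt_val φ⟩, ?_⟩
  have h4 := congrArg (fun ψ => ψ.hom (Ideal.Quotient.mk _ 1)) h3
  exact h4.trans (qhom_one c t z ht)

lemma SES.V1_of_gam_surj (h : SES f g) {c : Ideal R} (hB : Module.Injective R B)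
    (H : ∀ z ∈ gam c C, ∃ y ∈ gam c B, g y = z) : V c 1 A := by
  intro t e
  have hB' : Injective h.sc.X₂ := Module.injective_object_of_injective_module R B
  obtain ⟨e', he'⟩ := Abelian.Ext.covariant_sequence_exact₁ _ h.short e 
    (Abelian.Ext.eq_zero_of_injective _) (n₀ := 0) rfl
  obtain ⟨φ, rfl⟩ := (Abelian.Ext.mk₀_bijective _ _).2 e'
  obtain ⟨y, ⟨k, hk⟩, hy⟩ := H (φ.hom (Ideal.Quotient.mk _ 1)) ⟨t, Qt_val φ⟩
  have hk' : ∀ r ∈ c ^ (t + k), r • y = 0 := fun r hr => hk r (Ideal.pow_le_pow_right (by lia) hr)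
  refine ⟨t + k, by lia, ?_⟩
  have e1 : tr c (by lia : t ≤ t + k) ≫ φ = qhom c (t+k) y hk' ≫ h.sc.g := by
    apply Qt_ext
    have := congrArg g (qhom_one c (t+k) y hk')
    exact (hy.symm.trans this.symm)
  rw [← he', Abelian.Ext.mk₀_comp_mk₀_assoc, e1, ← Abelian.Ext.mk₀_comp_mk₀_assoc,
    h.short.comp_extClass, Abelian.Ext.comp_zero]

end vee
end LC

open CategoryTheory

namespace LC
open Limits Opposite

section alg
variable {R : Type} [CommRing R]
variable {A B C : Type} [AddCommGroup A] [Module R A] [AddCommGroup B] [Module R B]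
  [AddCommGroup C] [Module R C] 

lemma SES_sub (S : Submodule R A) : SES S.subtype S.mkQ :=
  ⟨S.injective_subtype, LinearMap.exact_subtype_mkQ S, S.mkQ_surjective⟩

lemma SES_inj (f : A →ₗ[R] B) (hf : Function.Injective f) : SES f (LinearMap.range f).mkQ :=
  ⟨hf, LinearMap.exact_map_mkQ_range f, Submodule.mkQ_surjective _⟩

lemma SES_ker (f : A →ₗ[R] B) : SES (LinearMap.ker f).subtype f.rangeRestrict := by
  refine ⟨Submodule.injective_subtype _, ?_, f.surjective_rangeRestrict⟩
  intro x
  simp [Subtype.ext_iff]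

lemma SES_surj (f : A →ₗ[R] B) (hf : Function.Surjective f) : SES (LinearMap.ker f).subtype f := 
  ⟨Submodule.injective_subtype _, LinearMap.exact_subtype_ker_map f, hf⟩

lemma V_congr (e : A ≃ₗ[R] B) {c : Ideal R} {p : ℕ} (h : V c p A) : V c p B := by
  have : SES (e : A →ₗ[R] B) (0 : B →ₗ[R] PUnit.{1}) := 
    ⟨e.injective, fun x => by simpa using e.surjective x, fun x => ⟨0, Subsingleton.elim _ _⟩⟩
  exact this.V2 h (V_of_subsingleton c p _)

lemma exists_inj (N : Type) [AddCommGroup N] [Module R N] :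
    ∃ (E : Type) (_ : AddCommGroup E) (_ : Module R E) (i : N →ₗ[R] E), 
      Function.Injective i ∧ Module.Injective R E := by
  let J := Injective.under (ModuleCat.of R N)
  refine ⟨J, inferInstance, inferInstance, (Injective.ι (ModuleCat.of R N)).hom, ?_, ?_⟩
  · rw [← ModuleCat.mono_iff_injective]; infer_instance
  · have : Injective (ModuleCat.of R J) := inferInstanceAs (Injective J)
    exact Module.injective_module_of_injective_object R J

lemma gam_map {c : Ideal R} (f : A →ₗ[R] B) {x : A} (hx : x ∈ gam c A) : f x ∈ gam c B := by
  obtain ⟨k, hk⟩ := hx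
  exact ⟨k, fun r hr => by rw [← map_smul, hk r hr, map_zero]⟩

lemma gam_of_inj {c : Ideal R} (f : A →ₗ[R] B) (hf : Function.Injective f) {x : A} 
    (hx : f x ∈ gam c B) : x ∈ gam c A := by
  obtain ⟨k, hk⟩ := hx
  exact ⟨k, fun r hr => hf (by rw [map_smul, hk r hr, map_zero])⟩

lemma gam_coe {c : Ideal R} {S : Submodule R A} (x : S) : x ∈ gam c S ↔ (x : A) ∈ gam c A :=
  ⟨fun h => gam_map S.subtype h, fun h => gam_of_inj S.subtype S.injective_subtype h⟩

lemma gam_sup (c d : Ideal R) (x : A) : x ∈ gam (c ⊔ d) A ↔ x ∈ gam c A ∧ x ∈ gam d A := by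
  constructor
  · rintro ⟨k, hk⟩
    exact ⟨⟨k, fun r hr => hk r (Ideal.pow_right_mono le_sup_left k hr)⟩,
      ⟨k, fun r hr => hk r (Ideal.pow_right_mono le_sup_right k hr)⟩⟩
  · rintro ⟨⟨k, hk⟩, ⟨l, hl⟩⟩
    refine ⟨k + l, fun r hr => ?_⟩
    obtain ⟨u, hu, v, hv, rfl⟩ := Submodule.mem_sup.1 (Ideal.sup_pow_add_le_pow_sup_pow hr)
    rw [add_smul, hk u hu, hl v hv, add_zero]

lemma gam_mono {c d : Ideal R} (h : c ≤ d) {x : A} (hx : x ∈ gam d A) : x ∈ gam c A := by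
  obtain ⟨k, hk⟩ := hx
  exact ⟨k, fun r hr => hk r (Ideal.pow_right_mono h k hr)⟩

lemma gam_span (x : R) (y : A) : y ∈ gam (Ideal.span {x}) A ↔ ∃ k : ℕ, x ^ k • y = 0 := by
  simp only [mem_gam, Ideal.span_singleton_pow, Ideal.mem_span_singleton]
  constructor
  · rintro ⟨k, hk⟩; exact ⟨k, hk _ dvd_rfl⟩
  · rintro ⟨k, hk⟩
    refine ⟨k, ?_⟩
    rintro _ ⟨r, rfl⟩
    rw [mul_comm, mul_smul, hk, smul_zero]

variable [IsNoetherianRing R]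

lemma gam_injective (a : Ideal R) (E : Type) [AddCommGroup E] [Module R E]
    (hE : Module.Injective R E) : Module.Injective R (gam a E) := by
  apply Module.Baer.injective
  intro I g
  -- bounded torsion
  obtain ⟨t, ht⟩ : ∃ t : ℕ, ∀ x : I, ∀ r ∈ a ^ t, r • g x = 0 := by
    let F : ℕ →o Submodule R I := 
      { toFun := fun k => 
          { carrier := {x | ∀ r ∈ a ^ k, r • g x = 0}
            add_mem' := fun {x y} hx hy r hr => by rw [map_add, smul_add, hx r hr, hy r hr, add_zero]
            zero_mem' := fun r _ => by rw [map_zero, smul_zero]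
            smul_mem' := fun s x hx r hr => by rw [map_smul, smul_comm, hx r hr, smul_zero] }
        monotone' := fun k l hkl x hx r hr => hx r (Ideal.pow_le_pow_right hkl hr) }
    obtain ⟨n, hn⟩ := monotone_stabilizes_iff_noetherian.2 (inferInstance : IsNoetherian R I) F
    refine ⟨n, fun x => ?_⟩
    obtain ⟨k, hk⟩ := (g x).2
    have h1 : x ∈ F (n + k) := fun r hr => 
      Subtype.ext (hk r (Ideal.pow_le_pow_right (by lia) hr))
    rw [← hn (n + k) (by lia)] at h1
    exact h1
  obtain ⟨G, hG⟩ := Module.Baer.of_injective hE I ((gam a E).subtype ∘ₗ g)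
  obtain ⟨k, hk⟩ := Ideal.exists_pow_inf_eq_pow_smul (M := R) a I
  have hs := hk (k + t) (by lia)
  have hkill : ∀ x ∈ I, x ∈ a ^ (k + t) → G x = 0 := by
    intro x hx hxa
    have h1 : x ∈ a ^ (k + t) • (⊤ : Submodule R R) ⊓ I := ⟨by simpa using hxa, hx⟩
    rw [hs, show k + t - k = t by lia] at h1
    refine Submodule.smul_induction_on h1 ?_ ?_
    · intro r hr n hn
      rw [map_smul, hG n hn.2]
      exact congrArg Subtype.val (ht ⟨n, hn.2⟩ r hr)
    · intro x y hx hy; rw [map_add, hx, hy, add_zero]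
  let j : I →ₗ[R] (R ⧸ a ^ (k + t)) := (Submodule.mkQ (a ^ (k+t))) ∘ₗ (Submodule.subtype I)
  have hj : ∀ x : I, j x = 0 → G x.1 = 0 := fun x hx => 
    hkill x.1 x.2 ((Submodule.Quotient.mk_eq_zero _).1 hx)
  let j' := (LinearMap.ker j).liftQ j le_rfl
  have hj' : Function.Injective j' := by
    rw [← LinearMap.ker_eq_bot]; exact Submodule.ker_liftQ_eq_bot _ _ _ le_rfl
  obtain ⟨h, hh⟩ := hE.out j' hj' ((LinearMap.ker j).liftQ (G ∘ₗ Submodule.subtype I) 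
    (fun x hx => hj x hx))
  let e1 := h (Submodule.Quotient.mk 1)
  have he : ∀ r : R, r • e1 = h (Submodule.Quotient.mk r) := by
    intro r
    rw [← map_smul, ← Submodule.Quotient.mk_smul, smul_eq_mul, mul_one]
  have he1 : e1 ∈ gam a E := ⟨k + t, fun r hr => by 
    rw [he, (Submodule.Quotient.mk_eq_zero _).2 hr, map_zero]⟩
  refine ⟨LinearMap.toSpanSingleton R _ ⟨e1, he1⟩, fun x hx => Subtype.ext ?_⟩
  have := hh (Submodule.Quotient.mk ⟨x, hx⟩)
  refine (he x).trans (this.trans (hG x hx))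

lemma V_torsion {c : Ideal R} (p : ℕ) (hp : 1 ≤ p) (N : Type) [AddCommGroup N] [Module R N]
    (h : ∀ x : N, x ∈ gam c N) : V c p N := by
  induction p, hp using Nat.le_induction generalizing N with
  | base =>
    obtain ⟨E, _, _, i, hi, hE⟩ := exists_inj (R := R) N
    let i' : N →ₗ[R] gam c E := LinearMap.codRestrict _ i (fun x => gam_map i (h x))
    have hi' : Function.Injective i' := fun x y hxy => hi (congrArg Subtype.val hxy)
    refine (SES_inj i' hi').V1_of_gam_surj (gam_injective c E hE) fun z _ => ?_
    obtain ⟨y, rfl⟩ := Submodule.mkQ_surjective _ z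
    exact ⟨y, (gam_coe y).2 y.2, rfl⟩
  | succ p hp ih =>
    obtain ⟨E, _, _, i, hi, hE⟩ := exists_inj (R := R) N
    let i' : N →ₗ[R] gam c E := LinearMap.codRestrict _ i (fun x => gam_map i (h x))
    have hi' : Function.Injective i' := fun x y hxy => hi (congrArg Subtype.val hxy)
    refine (SES_inj i' hi').V1 (ih _ fun z => ?_) (V_of_injective c _ (by lia) _ 
      (gam_injective c E hE))
    obtain ⟨y, rfl⟩ := Submodule.mkQ_surjective _ z
    exact gam_map _ ((gam_coe y).2 y.2)

lemma finsupp_injective (ι : Type) (E : Type) [AddCommGroup E] [Module R E]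
    (hE : Module.Injective R E) : Module.Injective R (ι →₀ E) := by
  classical
  apply Module.Baer.injective
  intro I g
  obtain ⟨s, hs⟩ := (inferInstance : IsNoetherian R I).noetherian ⊤
  let S : Finset ι := s.biUnion (fun x => (g x).support)
  have hS : ∀ x : I, g x ∈ Finsupp.supported E R (S : Set ι) := by
    have : (⊤ : Submodule R I) ≤ (Finsupp.supported E R (S : Set ι)).comap g := by
      rw [← hs, Submodule.span_le]
      intro x hx
      refine (Finsupp.mem_supported R _).2 ?_
      exact_mod_cast Finset.subset_biUnion_of_mem (fun x => (g x).support) hx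
    exact fun x => this trivial
  have hB := Module.Baer.of_injective hE
  choose G hG using fun i => hB I ((Finsupp.lapply i) ∘ₗ g)
  let e : ι →₀ E := Finsupp.onFinset S (fun i => if i ∈ S then G i 1 else 0) 
    (fun i hi => by by_contra h; simp [h] at hi)
  refine ⟨LinearMap.toSpanSingleton R _ e, fun x hx => Finsupp.ext fun i => ?_⟩
  by_cases hi : i ∈ S
  · have := hG i x hx
    simp only [LinearMap.toSpanSingleton_apply, Finsupp.smul_apply, e, Finsupp.onFinset_apply, 
      if_pos hi]
    rw [← map_smul, smul_eq_mul, mul_one, this]; rfl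
  · simp only [LinearMap.toSpanSingleton_apply, Finsupp.smul_apply, e, Finsupp.onFinset_apply, 
      if_neg hi, smul_zero]
    have := (Finsupp.mem_supported' R _).1 (hS ⟨x, hx⟩) i (by simpa using hi)
    exact this.symm

lemma SES_finsupp {f : A →ₗ[R] B} {g : B →ₗ[R] C} (h : SES f g) (ι : Type) :
    SES (Finsupp.mapRange.linearMap (α := ι) f) (Finsupp.mapRange.linearMap (α := ι) g) := by
  refine ⟨?_, ?_, ?_⟩
  · exact Finsupp.mapRange_injective f (map_zero f) h.inj
  · intro y
    constructor
    · intro hy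
      have h1 : ∀ i, ∃ x, f x = y i := fun i => (h.ex (y i)).1 (by
        have := DFunLike.congr_fun hy i
        simpa using this)
      choose x hx using h1
      refine ⟨Finsupp.onFinset y.support x (fun i hi => ?_), ?_⟩
      · rw [Finsupp.mem_support_iff, ← hx]
        intro h0
        exact hi (h.inj (by rw [h0, map_zero]))
      · ext i; simp [hx]
    · rintro ⟨x, rfl⟩
      ext i
      simpa using (h.ex (f (x i))).2 ⟨_, rfl⟩
  · exact Finsupp.mapRange_surjective g (map_zero g) h.surj

lemma V_finsupp {c : Ideal R} (p : ℕ) (hp : 1 ≤ p) (ι : Type) (N : Type) [AddCommGroup N] 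
    [Module R N] (h : V c p N) : V c p (ι →₀ N) := by
  induction p, hp using Nat.le_induction generalizing N with
  | base =>
    classical
    obtain ⟨E, _, _, i, hi, hE⟩ := exists_inj (R := R) N
    refine (SES_finsupp (SES_inj i hi) ι).V1_of_gam_surj (finsupp_injective ι E hE) fun z hz => ?_
    have hz' : ∀ k, z k ∈ gam c _ := fun k => gam_map (Finsupp.lapply k) hz
    choose y hy1 hy2 using fun k => (SES_inj i hi).gam_surj h (z k) (hz' k)
    let w : ι →₀ E := Finsupp.onFinset z.support (fun k => if k ∈ z.support then y k else 0)
      (fun i hi => by by_contra h; simp [h] at hi)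
    refine ⟨w, ?_, ?_⟩
    · rw [← Finsupp.sum_single w]
      refine Submodule.sum_mem _ fun k _ => ?_
      refine gam_map (Finsupp.lsingle k) ?_
      simp only [w, Finsupp.onFinset_apply]
      split_ifs
      · exact hy1 k
      · exact zero_mem _
    · ext k
      by_cases hk : k ∈ z.support
      · simp only [Finsupp.mapRange.linearMap_apply, Finsupp.mapRange_apply, w, 
          Finsupp.onFinset_apply, if_pos hk, hy2]
      · simp only [Finsupp.mapRange.linearMap_apply, Finsupp.mapRange_apply, w, 
          Finsupp.onFinset_apply, if_neg hk, map_zero]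
        simpa using (Finsupp.notMem_support_iff.1 hk).symm
  | succ p hp ih =>
    obtain ⟨E, _, _, i, hi, hE⟩ := exists_inj (R := R) N
    have h1 := (SES_inj i hi).V3 (V_of_injective c p hp E hE) h
    exact (SES_finsupp (SES_inj i hi) ι).V1 (ih _ h1) (V_of_injective c _ (by lia) _ 
      (finsupp_injective ι E hE))

lemma V_sup_torsion {c : Ideal R} (x : R) (p : ℕ) (hp : 1 ≤ p) (N : Type) [AddCommGroup N] 
    [Module R N] (hx : ∀ y : N, y ∈ gam (Ideal.span {x}) N) (h : V c p N) : 
    V (Ideal.span {x} ⊔ c) p N := by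
  induction p, hp using Nat.le_induction generalizing N with
  | base =>
    obtain ⟨E, _, _, i, hi, hE⟩ := exists_inj (R := R) N
    let i' : N →ₗ[R] gam (Ideal.span {x}) E := 
      LinearMap.codRestrict _ i (fun y => gam_map i (hx y))
    have hi' : Function.Injective i' := fun x y hxy => hi (congrArg Subtype.val hxy)
    refine (SES_inj i' hi').V1_of_gam_surj (gam_injective _ E hE) fun z hz => ?_
    obtain ⟨y, hy, rfl⟩ := (SES_inj i' hi').gam_surj h z ((gam_sup _ _ _).1 hz).2
    exact ⟨y, (gam_sup _ _ _).2 ⟨(gam_coe y).2 y.2, hy⟩, rfl⟩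
  | succ p hp ih =>
    obtain ⟨E, _, _, i, hi, hE⟩ := exists_inj (R := R) N
    let i' : N →ₗ[R] gam (Ideal.span {x}) E := 
      LinearMap.codRestrict _ i (fun y => gam_map i (hx y))
    have hi' : Function.Injective i' := fun x y hxy => hi (congrArg Subtype.val hxy)
    have hG := gam_injective (Ideal.span {x}) E hE
    have h1 := (SES_inj i' hi').V3 (V_of_injective c p hp _ hG) h
    refine (SES_inj i' hi').V1 (ih _ (fun z => ?_) h1) (V_of_injective _ _ (by lia) _ hG)
    obtain ⟨y, rfl⟩ := Submodule.mkQ_surjective _ z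
    exact gam_map _ ((gam_coe y).2 y.2)

lemma V_bij {c : Ideal R} (x : R) (hxc : x ∈ c) (p : ℕ) (W : Type) [AddCommGroup W] 
    [Module R W] (hx : IsUnit (algebraMap R (Module.End R W) x)) : V c p W := by
  intro t e
  refine ⟨t, le_rfl, ?_⟩
  suffices e = 0 by rw [this, Abelian.Ext.comp_zero]
  have hu := hx.pow t
  obtain ⟨u, hu⟩ := hu.exists_left_inv
  rw [← map_pow] at hu
  let U : ModuleCat.of R W ⟶ ModuleCat.of R W := ModuleCat.ofHom u
  have h1 : (x ^ t • 𝟙 (ModuleCat.of R W)) ≫ U = 𝟙 _ := by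
    refine ModuleCat.hom_ext (LinearMap.ext fun y => ?_)
    exact LinearMap.congr_fun hu y
  have h2 : x ^ t • e = 0 := by
    have h3 : x ^ t • 𝟙 (Qt c t) = 0 := by
      apply Qt_ext
      have := Qt_val (𝟙 (Qt c t)) (x ^ t) (Ideal.pow_mem_pow hxc t)
      exact this
    rw [← Abelian.Ext.mk₀_id_comp e, ← Abelian.Ext.smul_comp, ← Abelian.Ext.mk₀_smul, h3]
    simp
  rw [Abelian.Ext.smul_eq_comp_mk₀] at h2
  have h4 := congrArg (fun z => z.comp (Abelian.Ext.mk₀ U) (add_zero p)) h2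
  simp only [Abelian.Ext.comp_assoc_of_third_deg_zero, Abelian.Ext.mk₀_comp_mk₀, h1, 
    Abelian.Ext.comp_mk₀_id, Abelian.Ext.zero_comp] at h4
  exact h4

lemma V_bound_list (l : List R) (p : ℕ) (hp : l.length < p) (N : Type) [AddCommGroup N] 
    [Module R N] : V (Ideal.span {x | x ∈ l}) p N := by
  induction l generalizing p N with
  | nil =>
    have : Ideal.span {x : R | x ∈ ([] : List R)} = ⊥ := by simp
    rw [this]
    refine V_torsion p (Nat.lt_of_le_of_lt (Nat.zero_le _) hp) N fun x => ⟨1, fun r hr => ?_⟩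
    simp at hr
    simp [hr]
  | cons x l ih =>
    have e : Ideal.span {y : R | y ∈ x :: l} = Ideal.span {x} ⊔ Ideal.span {y | y ∈ l} := by
      rw [← Ideal.span_union]; congr 1; ext y; simp
    rw [e]
    have hp' : l.length + 1 < p := by simpa using hp
    obtain ⟨q, rfl⟩ : ∃ q, p = q + 1 := ⟨p - 1, by lia⟩
    have ht : ∀ (T : Type) [AddCommGroup T] [Module R T], (∀ y : T, y ∈ gam (Ideal.span {x}) T) →
        ∀ p, l.length < p → V (Ideal.span {x} ⊔ Ideal.span {y | y ∈ l}) p T := 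
      fun T _ _ hT p hp => V_sup_torsion x p (by lia) T hT (ih p hp T)
    let W := LocalizedModule (Submonoid.powers x) N
    let φ : N →ₗ[R] W := LocalizedModule.mkLinearMap (Submonoid.powers x) N
    refine (SES_ker φ).V2 (ht _ ?_ _ (by lia)) ?_
    · rintro ⟨y, hy⟩
      rw [gam_coe, gam_span]
      have h0 : φ y = φ 0 := by rw [map_zero]; exact hy
      obtain ⟨⟨_, k, rfl⟩, hk⟩ := IsLocalizedModule.exists_of_eq (S := Submonoid.powers x) h0
      refine ⟨k, ?_⟩
      have hk' : x ^ k • y = x ^ k • (0 : N) := hk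
      rw [hk', smul_zero]
    · refine (SES_sub (LinearMap.range φ)).V1 (ht _ ?_ _ (by lia)) 
        (V_bij x (Ideal.mem_sup_left (Ideal.mem_span_singleton_self x)) _ _ 
          (IsLocalizedModule.map_units φ ⟨x, Submonoid.mem_powers x⟩))
      intro z
      obtain ⟨w, rfl⟩ := Submodule.mkQ_surjective _ z
      rw [gam_span]
      obtain ⟨⟨n, ⟨_, k, rfl⟩⟩, hk⟩ := IsLocalizedModule.surj (Submonoid.powers x) φ w
      refine ⟨k, ?_⟩
      have hk' : x ^ k • w = φ n := hk
      rw [← map_smul, hk']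
      exact (Submodule.Quotient.mk_eq_zero _).2 ⟨n, rfl⟩

lemma V_bound (c : Ideal R) : ∃ n : ℕ, ∀ p, n < p → ∀ (N : Type) [AddCommGroup N] 
    [Module R N], V c p N := by
  obtain ⟨s, rfl⟩ := (isNoetherianRing_iff_ideal_fg R).1 inferInstance c
  refine ⟨s.toList.length, fun p hp N _ _ => ?_⟩
  have := V_bound_list s.toList p hp N
  simpa using this

end alg
end LC

open CategoryTheory

namespace LC
open Limits Opposite

section semi
variable {R : Type} [CommRing R]

/-- a submodule annihilated by everything killing the ambient ideal -/
def Kill (I : Ideal R) (N : Type) [AddCommGroup N] [Module R N] : Prop :=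
  ∀ r ∈ I, ∀ x : N, r • x = 0

lemma exists_functional [IsNoetherianRing R] (M : Type) [AddCommGroup M] [Module R M] 
    [Module.Finite R M] (P : Ideal R) (hP : P.IsPrime) 
    (hM : ∀ r : R, (∀ m : M, r • m = 0) → r ∈ P) : ∃ φ : M →ₗ[R] R ⧸ P, φ ≠ 0 := by
  have : IsNoetherian R M := inferInstance
  let T : Set (Submodule R M) := {K | ∀ r : R, (∀ m : M, r • m ∈ K) → r ∈ P}
  obtain ⟨K, hK, hmax⟩ := WellFounded.has_min (wellFounded_gt (α := Submodule R M)) T 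
    ⟨⊥, fun r hr => hM r (by simpa using hr)⟩
  obtain ⟨x, hx⟩ : ∃ x, x ∉ K := by
    by_contra h
    push Not at h
    exact hP.ne_top ((Ideal.eq_top_iff_one _).2 (hK 1 (fun m => h _)))
  have hL : K ⊔ Submodule.span R {x} ∉ T := fun h => hmax _ h (by
    refine lt_of_le_of_ne le_sup_left (fun h => hx ?_)
    rw [h]; exact Submodule.mem_sup_right (Submodule.mem_span_singleton_self x))
  simp only [T, Set.mem_ofPred_eq, not_forall] at hL
  obtain ⟨t, ht, htP⟩ := hL
  let q := K.mkQ
  let σ : R →ₗ[R] (M ⧸ K) := LinearMap.toSpanSingleton R _ (q x)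
  have hker : LinearMap.ker σ ≤ P := by
    intro s hs
    have hs' : s • x ∈ K := by
      rw [← Submodule.Quotient.mk_eq_zero]; exact hs
    have : s * t ∈ P := hK _ fun m => by
      obtain ⟨k, hk, y, hy, hky⟩ := Submodule.mem_sup.1 (ht m)
      obtain ⟨r, rfl⟩ := Submodule.mem_span_singleton.1 hy
      rw [mul_smul, ← hky, smul_add, smul_comm s r]
      exact add_mem (K.smul_mem _ hk) (K.smul_mem _ hs')
    exact (hP.mem_or_mem this).resolve_right htP
  have hrange : ∀ m : M, t • q m ∈ LinearMap.range σ := by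
    intro m
    obtain ⟨k, hk, y, hy, hky⟩ := Submodule.mem_sup.1 (ht m)
    obtain ⟨r, rfl⟩ := Submodule.mem_span_singleton.1 hy
    refine ⟨r, ?_⟩
    rw [← map_smul, ← hky, map_add, map_smul]
    have : q k = 0 := (Submodule.Quotient.mk_eq_zero _).2 hk
    rw [this, zero_add]; rfl
  let τ : M →ₗ[R] LinearMap.range σ := LinearMap.codRestrict _ (t • q) hrange
  let φ : M →ₗ[R] R ⧸ P := (Submodule.mapQ (LinearMap.ker σ) P LinearMap.id hker) ∘ₗ 
    σ.quotKerEquivRange.symm.toLinearMap ∘ₗ τ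
  refine ⟨φ, fun h0 => htP ?_⟩
  have h1 : φ x = 0 := by rw [h0]; rfl
  have h2 : σ.quotKerEquivRange.symm (τ x) = Submodule.Quotient.mk t := by
    rw [LinearEquiv.symm_apply_eq]
    exact Subtype.ext rfl
  have h3 : φ x = Submodule.Quotient.mk t := by
    change (Submodule.mapQ (LinearMap.ker σ) P LinearMap.id hker) (σ.quotKerEquivRange.symm (τ x)) = _
    rw [h2]; rfl
  rw [h3] at h1
  exact (Submodule.Quotient.mk_eq_zero _).1 h1

lemma V_semi_step [IsNoetherianRing R] (c : Ideal R) (p : ℕ) (hp : 1 ≤ p)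
    (M : Type) [AddCommGroup M] [Module R M] [Module.Finite R M] (A : Ideal R) 
    (hA : ∀ r : R, r ∈ A ↔ (∀ m : M, r • m = 0)) (hM : V c p M) 
    (hnext : ∀ (N : Type) [AddCommGroup N] [Module R N], Kill A N → V c (p+1) N)
    (N : Type) [AddCommGroup N] [Module R N] (hN : Kill A N) : V c p N := by
  have hquot : ∀ (B C : Type) [AddCommGroup B] [Module R B] [AddCommGroup C] [Module R C] 
      (g : B →ₗ[R] C), Function.Surjective g → Kill A B → V c p B → V c p C := by
    intro B C _ _ _ _ g hg hB hV
    exact (SES_surj g hg).V3 hV (hnext _ fun r hr x => Subtype.ext (hB r hr x.1))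
  suffices H : ∀ I : Ideal R, A ≤ I → ∀ (N : Type) [AddCommGroup N] [Module R N], 
      Kill I N → V c p N from H A le_rfl N hN
  clear hN
  intro I
  induction I using WellFoundedGT.induction with
  | ind I ih =>
  intro hAI N _ _ hN
  by_cases htop : I = ⊤
  · have : Subsingleton N := subsingleton_of_forall_eq 0 fun x => by
      rw [← one_smul R x]; exact hN 1 (by rw [htop]; trivial) x
    exact V_of_subsingleton c p N
  by_cases hprime : I.IsPrime
  · obtain ⟨φ, hφ⟩ := exists_functional M I hprime fun r hr => hAI ((hA r).2 hr)
    let S := LinearMap.range φ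
    have hAM : Kill A (N →₀ M) := fun r hr x => Finsupp.ext fun i => by simpa using (hA r).1 hr (x i)
    have v1 : V c p (N →₀ S) := hquot (N →₀ M) (N →₀ S) 
      (Finsupp.mapRange.linearMap φ.rangeRestrict) 
      (Finsupp.mapRange_surjective _ (map_zero _) φ.surjective_rangeRestrict) hAM
      (V_finsupp p hp N M hM)
    have v2 : V c p (N →₀ ((R ⧸ I) ⧸ S)) := by
      let J : Ideal R := S.comap (Submodule.mkQ I)
      have hIJ : I ≤ J := fun r hr => by
        change Submodule.mkQ I r ∈ S
        have : Submodule.mkQ I r = 0 := (Submodule.Quotient.mk_eq_zero _).2 hr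
        rw [this]; exact zero_mem _
      have hJ : I < J := by
        refine lt_of_le_of_ne hIJ fun h => hφ (LinearMap.ext fun m => ?_)
        obtain ⟨r, hr⟩ := Submodule.mkQ_surjective I (φ m)
        have : r ∈ J := by change Submodule.mkQ I r ∈ S; rw [hr]; exact ⟨m, rfl⟩
        rw [← h] at this
        rw [← hr]; exact (Submodule.Quotient.mk_eq_zero _).2 this
      refine ih J hJ (hAI.trans hIJ) _ fun r hr x => Finsupp.ext fun i => ?_
      obtain ⟨y, hy⟩ := Submodule.mkQ_surjective _ (x i)
      obtain ⟨s, rfl⟩ := Submodule.mkQ_surjective _ y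
      rw [Finsupp.smul_apply, ← hy, ← map_smul, ← map_smul]
      refine (Submodule.Quotient.mk_eq_zero _).2 ?_
      have : r • s = s • r := mul_comm _ _
      rw [this, map_smul]
      exact S.smul_mem _ hr
    have v3 : V c p (N →₀ (R ⧸ I)) := (SES_finsupp (SES_sub S) N).V2 v1 v2
    let g : (N →₀ (R ⧸ I)) →ₗ[R] N := Finsupp.lsum ℕ fun x => 
      Submodule.liftQ I (LinearMap.toSpanSingleton R N x) (fun r hr => hN r hr x)
    refine hquot _ N g (fun x => ⟨Finsupp.single x (Submodule.Quotient.mk 1), ?_⟩) ?_ v3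
    · simp only [g, Finsupp.lsum_single]
      exact one_smul R x
    · intro r hr x
      refine Finsupp.ext fun i => ?_
      obtain ⟨s, hs⟩ := Submodule.mkQ_surjective _ (x i)
      rw [Finsupp.smul_apply, ← hs, ← map_smul]
      exact (Submodule.Quotient.mk_eq_zero _).2 (I.mul_mem_right _ (hAI hr))
  · obtain h | ⟨x, hx, y, hy, hxy⟩ := Ideal.not_isPrime_iff.1 hprime
    · exact absurd h htop
    have hlt : ∀ z, z ∉ I → I < I ⊔ Ideal.span {z} := fun z hz => by
      refine lt_of_le_of_ne le_sup_left fun h => hz ?_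
      rw [h]; exact Ideal.mem_sup_right (Ideal.mem_span_singleton_self z)
    have hk : ∀ (z : R) (L : Type) [AddCommGroup L] [Module R L], Kill I L → 
        (∀ l : L, z • l = 0) → Kill (I ⊔ Ideal.span {z}) L := by
      intro z L _ _ hL hz r hr l
      obtain ⟨u, hu, v, hv, rfl⟩ := Submodule.mem_sup.1 hr
      obtain ⟨w, rfl⟩ := Ideal.mem_span_singleton'.1 hv
      rw [add_smul, hL u hu, mul_smul, hz, smul_zero, add_zero]
    let S := LinearMap.range (LinearMap.lsmul R N x)
    refine (SES_sub S).V2 (ih _ (hlt y hy) (hAI.trans le_sup_left) _ (hk y _ ?_ ?_)) 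
      (ih _ (hlt x hx) (hAI.trans le_sup_left) _ (hk x _ ?_ ?_))
    · exact fun r hr l => Subtype.ext (hN r hr l.1)
    · rintro ⟨_, l, rfl⟩
      refine Subtype.ext ?_
      change y • x • l = 0
      rw [← mul_smul, mul_comm]; exact hN _ hxy l
    · intro r hr l
      obtain ⟨l, rfl⟩ := Submodule.mkQ_surjective _ l
      rw [← map_smul, hN r hr, map_zero]
    · intro l
      obtain ⟨l, rfl⟩ := Submodule.mkQ_surjective _ l
      rw [← map_smul]
      exact (Submodule.Quotient.mk_eq_zero _).2 ⟨l, rfl⟩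

lemma V_semi [IsNoetherianRing R] (c : Ideal R) (d : ℕ)
    (M : Type) [AddCommGroup M] [Module R M] [Module.Finite R M] 
    (hM : ∀ p, d < p → V c p M) (p : ℕ) (hp : d < p)
    (N : Type) [AddCommGroup N] [Module R N] 
    (hN : ∀ r : R, (∀ m : M, r • m = 0) → ∀ x : N, r • x = 0) : V c p N := by
  obtain ⟨n, hn⟩ := V_bound c
  let A : Ideal R := Module.annihilator R M
  have hA : ∀ r : R, r ∈ A ↔ (∀ m : M, r • m = 0) := fun r => Module.mem_annihilator
  have key : ∀ k p, d < p → n < p + k → ∀ (N : Type) [AddCommGroup N] [Module R N], 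
      Kill A N → V c p N := by
    intro k
    induction k with
    | zero => intro p _ hnp N _ _ _; exact hn p (by simpa using hnp) N
    | succ k ih =>
      intro p hdp hnp N _ _ hN
      exact V_semi_step c p (by lia) M A hA (hM p hdp) (fun N _ _ hN => ih (p+1) (by lia) (by lia) N hN)
        N hN
  exact key (n+1) p hp (by lia) N fun r hr => hN r ((hA r).1 hr)

end semi
end LC

open CategoryTheory

namespace LC
open Limits Opposite

section main
variable {R : Type} [CommRing R] {M : ModuleCat.{0} R}

lemma V_of_lc (c : Ideal R) (p : ℕ) (h : Subsingleton ((localCohomology c p).obj M)) : V c p M :=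
  fun t e => (lci_zero c p M t e).1 (Subsingleton.elim _ _)

lemma lc_of_V (c : Ideal R) (p : ℕ) (h : V c p M) : Subsingleton ((localCohomology c p).obj M) := by
  refine subsingleton_of_forall_eq 0 fun x => ?_
  obtain ⟨t, e, rfl⟩ := lci_surj c p M x
  exact (lci_zero c p M t e).2 (h t e)

lemma V_of_cohDim [IsNoetherianRing R] (c : Ideal R) (p : ℕ) (hp : cohDim c M < p) : V c p M := by
  obtain ⟨n, hn⟩ := V_bound c
  apply V_of_lc
  rw [← not_nontrivial_iff_subsingleton]
  intro h
  have hb : BddAbove {i : ℕ | Nontrivial ((localCohomology c i).obj M)} := by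
    refine ⟨n, fun i hi => ?_⟩
    by_contra hlt
    have := lc_of_V c i (hn i (by lia) M)
    exact not_nontrivial_iff_subsingleton.2 this hi
  have : p ≤ cohDim c M := le_csSup hb h
  lia

lemma lc_kill (c : Ideal R) (p : ℕ) (r : R) (hr : ∀ m : M, r • m = 0) 
    (x : (localCohomology c p).obj M) : r • x = 0 := by
  obtain ⟨t, e, rfl⟩ := lci_surj c p M x
  have h0 : r • 𝟙 M = 0 := ModuleCat.hom_ext (LinearMap.ext fun m => hr m)
  rw [← map_smul, Abelian.Ext.smul_eq_comp_mk₀, h0]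
  simp

variable (I : InjectiveResolution M)

/-- the differential -/
noncomputable def dd (q : ℕ) : I.cocomplex.X q →ₗ[R] I.cocomplex.X (q+1) := 
  (I.cocomplex.d q (q+1)).hom

lemma dd_dd (q : ℕ) (x : I.cocomplex.X q) : dd I (q+1) (dd I q x) = 0 :=
  congrArg (fun ψ => ψ.hom x) (I.cocomplex.d_comp_d q (q+1) (q+1+1))

noncomputable def Zc (a : Ideal R) (q : ℕ) : Submodule R (I.cocomplex.X q) :=
  gam a (I.cocomplex.X q) ⊓ LinearMap.ker (dd I q)

lemma qhom_d {a : Ideal R} {q t : ℕ} (z : I.cocomplex.X q) (hz : ∀ r ∈ a ^ t, r • z = 0)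
    (hd : dd I q z = 0) : (qhom a t z hz : Qt a t ⟶ I.cocomplex.X q) ≫ I.cocomplex.d q (q+1) = 0 := by
  apply Qt_ext
  exact (congrArg (dd I q) (qhom_one a t z hz)).trans hd

noncomputable def cz {a : Ideal R} {q t : ℕ} (z : I.cocomplex.X q) (hz : ∀ r ∈ a ^ t, r • z = 0)
    (hd : dd I q z = 0) : Abelian.Ext (Qt a t) M q :=
  I.extMk (qhom a t z hz) (q+1) rfl (qhom_d I z hz hd)

lemma cz_tr {a : Ideal R} {q t s : ℕ} (h : t ≤ s) (z : I.cocomplex.X q) 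
    (hz : ∀ r ∈ a ^ t, r • z = 0) (hd : dd I q z = 0) (hz' : ∀ r ∈ a ^ s, r • z = 0) : 
    (Abelian.Ext.mk₀ (tr a h)).comp (cz I z hz hd) (zero_add q) = cz I z hz' hd := by
  refine (I.mk₀_comp_extMk _ _ rfl (qhom_d I z hz hd) _).trans ?_
  unfold cz
  congr 1
  apply Qt_ext
  exact (qhom_one a t z hz).trans (qhom_one a s z hz').symm

lemma lci_cz {a : Ideal R} {q t s : ℕ} (z : I.cocomplex.X q) 
    (hz : ∀ r ∈ a ^ t, r • z = 0) (hd : dd I q z = 0) (hz' : ∀ r ∈ a ^ s, r • z = 0) : 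
    lci a q M t (cz I z hz hd) = lci a q M s (cz I z hz' hd) := by
  have hm : ∀ r ∈ a ^ (t + s), r • z = 0 := fun r hr => hz r (Ideal.pow_le_pow_right (by lia) hr)
  rw [← lci_tr a q M (by lia : t ≤ t + s), ← lci_tr a q M (by lia : s ≤ t + s), 
    cz_tr I _ z hz hd hm, cz_tr I _ z hz' hd hm]

lemma cz_add {a : Ideal R} {q t : ℕ} (z w : I.cocomplex.X q) (hz : ∀ r ∈ a ^ t, r • z = 0)
    (hd : dd I q z = 0) (hw : ∀ r ∈ a ^ t, r • w = 0) (hd' : dd I q w = 0) 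
    (hs : ∀ r ∈ a ^ t, r • (z + w) = 0) (hd'' : dd I q (z + w) = 0) : 
    cz I (z + w) hs hd'' = cz I z hz hd + cz I w hw hd' := by
  refine Eq.trans ?_ (I.add_extMk _ _ _ rfl (qhom_d I z hz hd) (qhom_d I w hw hd')).symm
  unfold cz
  congr 1
  apply Qt_ext
  refine (qhom_one a t _ hs).trans ?_
  exact (congrArg₂ (· + ·) (qhom_one a t _ hz) (qhom_one a t _ hw)).symm

lemma cz_smul {a : Ideal R} {q t : ℕ} (k : R) (z : I.cocomplex.X q) (hz : ∀ r ∈ a ^ t, r • z = 0)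
    (hd : dd I q z = 0) 
    (hs : ∀ r ∈ a ^ t, r • (k • z) = 0) (hd'' : dd I q (k • z) = 0) : 
    cz I (k • z) hs hd'' = k • cz I z hz hd := by
  have e1 : k • cz I z hz hd = (Abelian.Ext.mk₀ (k • 𝟙 (Qt a t))).comp (cz I z hz hd) (zero_add q) := by
    rw [Abelian.Ext.mk₀_smul, Abelian.Ext.smul_comp, Abelian.Ext.mk₀_id_comp]
  rw [e1]
  refine Eq.trans ?_ (I.mk₀_comp_extMk _ _ rfl (qhom_d I z hz hd) _).symm
  unfold cz
  congr 1
  apply Qt_ext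
  refine (qhom_one a t _ hs).trans ?_
  have := (qhom a t z hz).hom.map_smul k (Ideal.Quotient.mk (a^t) 1)
  exact ((this.trans (congrArg (k • ·) (qhom_one a t z hz)))).symm

noncomputable def Phi (a : Ideal R) (q : ℕ) : Zc I a q →ₗ[R] (localCohomology a q).obj M where
  toFun z := lci a q M z.2.1.choose (cz I z.1 z.2.1.choose_spec z.2.2)
  map_add' := by
    rintro ⟨z, hz⟩ ⟨w, hw⟩
    obtain ⟨t, ht⟩ := hz.1
    obtain ⟨s, hs⟩ := hw.1
    have hz' : ∀ r ∈ a ^ (t + s), r • z = 0 := fun r hr => ht r (Ideal.pow_le_pow_right (by lia) hr)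
    have hw' : ∀ r ∈ a ^ (t + s), r • w = 0 := fun r hr => hs r (Ideal.pow_le_pow_right (by lia) hr)
    have hzw : ∀ r ∈ a ^ (t + s), r • (z + w) = 0 := fun r hr => by
      rw [smul_add, hz' r hr, hw' r hr, add_zero]
    refine (lci_cz I (z + w) _ _ hzw).trans ?_
    refine Eq.trans ?_ (congrArg₂ (· + ·) (lci_cz I z _ hz.2 hz') (lci_cz I w _ hw.2 hw')).symm
    exact (congrArg (lci a q M (t+s)) (cz_add I z w hz' hz.2 hw' hw.2 hzw ((Zc I a q).add_mem hz hw).2)).trans (map_add _ _ _)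
  map_smul' := by
    rintro k ⟨z, hz⟩
    obtain ⟨t, ht⟩ := hz.1
    have hk : ∀ r ∈ a ^ t, r • (k • z) = 0 := fun r hr => by
      rw [smul_comm, ht r hr, smul_zero]
    refine (lci_cz I (k • z) _ _ hk).trans ?_
    refine Eq.trans ?_ (congrArg (k • ·) (lci_cz I z _ hz.2 ht)).symm
    exact (congrArg (lci a q M t) (cz_smul I k z ht hz.2 hk ((Zc I a q).smul_mem k hz).2)).trans (map_smul _ _ _)

lemma Phi_eq {a : Ideal R} {q t : ℕ} (z : Zc I a q) (hz : ∀ r ∈ a ^ t, r • z.1 = 0) :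
    Phi I a q z = lci a q M t (cz I z.1 hz z.2.2) := lci_cz I z.1 _ z.2.2 hz

lemma Phi_surj (a : Ideal R) (q : ℕ) : Function.Surjective (Phi I a q) := by
  intro x
  obtain ⟨t, e, rfl⟩ := lci_surj a q M x
  obtain ⟨f, hf, rfl⟩ := I.extMk_surjective e (q+1) rfl
  let z : I.cocomplex.X q := f.hom (Ideal.Quotient.mk _ 1)
  have hz : ∀ r ∈ a ^ t, r • z = 0 := Qt_val f
  have hd : dd I q z = 0 := congrArg (fun ψ => ψ.hom (Ideal.Quotient.mk _ 1)) hf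
  refine ⟨⟨z, ⟨t, hz⟩, hd⟩, ?_⟩
  rw [Phi_eq I _ hz]
  congr 1
  unfold cz
  congr 1
  apply Qt_ext
  exact qhom_one a t z hz

lemma Phi_zero_iff (a : Ideal R) (z : Zc I a 0) : Phi I a 0 z = 0 ↔ z = 0 := by
  constructor
  · intro h
    obtain ⟨t, ht⟩ := z.2.1
    rw [Phi_eq I z ht, lci_zero] at h
    obtain ⟨s, hts, h⟩ := h
    have ht' : ∀ r ∈ a ^ s, r • z.1 = 0 := fun r hr => ht r (Ideal.pow_le_pow_right hts hr)
    rw [cz_tr I hts z.1 ht z.2.2 ht'] at h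
    have h2 := (iextMk_zero_iff I _ _).1 h
    refine Subtype.ext ((qhom_one a s z.1 ht').symm.trans ?_)
    exact congrArg (fun ψ => ψ.hom (Ideal.Quotient.mk (a ^ s) 1)) h2
  · rintro rfl; exact map_zero _

lemma Phi_succ_iff (a : Ideal R) (q : ℕ) (z : Zc I a (q+1)) : Phi I a (q+1) z = 0 ↔ 
    ∃ y ∈ gam a (I.cocomplex.X q), dd I q y = z.1 := by
  constructor
  · intro h
    obtain ⟨t, ht⟩ := z.2.1
    rw [Phi_eq I z ht, lci_zero] at h
    obtain ⟨s, hts, h⟩ := h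
    have ht' : ∀ r ∈ a ^ s, r • z.1 = 0 := fun r hr => ht r (Ideal.pow_le_pow_right hts hr)
    rw [cz_tr I hts z.1 ht z.2.2 ht'] at h
    obtain ⟨g, hg⟩ := (I.extMk_eq_zero_iff _ _ rfl (qhom_d I z.1 ht' z.2.2) q rfl).1 h
    refine ⟨g.hom (Ideal.Quotient.mk (a ^ s) 1), ⟨s, Qt_val g⟩, ?_⟩
    refine Eq.trans ?_ (qhom_one a s z.1 ht')
    exact congrArg (fun ψ => ψ.hom (Ideal.Quotient.mk (a ^ s) 1)) hg
  · rintro ⟨y, ⟨t, ht⟩, hy⟩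
    have hz : ∀ r ∈ a ^ t, r • z.1 = 0 := fun r hr => by
      rw [← hy, ← map_smul, ht r hr, map_zero]
    rw [Phi_eq I z hz]
    have : cz I z.1 hz z.2.2 = 0 := by
      refine (I.extMk_eq_zero_iff _ _ rfl (qhom_d I z.1 hz z.2.2) q rfl).2 ⟨qhom a t y ht, ?_⟩
      apply Qt_ext
      refine Eq.trans ?_ (qhom_one a t z.1 hz).symm
      exact (congrArg (dd I q) (qhom_one a t y ht)).trans hy
    rw [this, map_zero]

/-- inclusion of cocycles -/
noncomputable def zinc (a : Ideal R) (q : ℕ) : Zc I a q →ₗ[R] gam a (I.cocomplex.X q) :=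
  Submodule.inclusion inf_le_left

lemma beta_mem (a : Ideal R) (q : ℕ) (y : gam a (I.cocomplex.X q)) : 
    dd I q y.1 ∈ Zc I a (q+1) := ⟨gam_map _ y.2, dd_dd I q y.1⟩

noncomputable def beta (a : Ideal R) (q : ℕ) : 
    gam a (I.cocomplex.X q) →ₗ[R] LinearMap.ker (Phi I a (q+1)) :=
  LinearMap.codRestrict _ (LinearMap.codRestrict _ ((dd I q) ∘ₗ (gam a _).subtype) (beta_mem I a q))
    (fun y => (Phi_succ_iff I a q _).2 ⟨y.1, y.2, rfl⟩)

lemma beta_val (a : Ideal R) (q : ℕ) (y : gam a (I.cocomplex.X q)) : 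
    ((beta I a q y).1).1 = dd I q y.1 := rfl

lemma SES_beta (a : Ideal R) (q : ℕ) : SES (zinc I a q) (beta I a q) := by
  refine ⟨Submodule.inclusion_injective _, ?_, ?_⟩
  · intro y
    constructor
    · intro h
      have : dd I q y.1 = 0 := by rw [← beta_val, h]; rfl
      exact ⟨⟨y.1, y.2, this⟩, rfl⟩
    · rintro ⟨z, rfl⟩
      exact Subtype.ext (Subtype.ext z.2.2)
  · rintro ⟨z, hz⟩
    obtain ⟨y, hy, hyz⟩ := (Phi_succ_iff I a q z).1 hz
    exact ⟨⟨y, hy⟩, Subtype.ext (Subtype.ext hyz)⟩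

lemma X_inj (q : ℕ) : Module.Injective R (I.cocomplex.X q) := by
  have : Injective (ModuleCat.of R (I.cocomplex.X q)) := I.injective q
  exact Module.injective_module_of_injective_object R _

lemma V_ZB [IsNoetherianRing R] [Module.Finite R M] (a c : Ideal R) (n : ℕ)
    (h : ∀ i, n ≤ i → ∀ x : (localCohomology a i).obj M, x ∈ gam c _) (q : ℕ) :
    ∀ p, 1 ≤ p → ((q < n ∧ cohDim c M + 1 ≤ p) ∨ (n ≤ q ∧ n + cohDim c M ≤ p + q)) →
      V c p (LinearMap.ker (Phi I a q)) ∧ V c p (Zc I a q) := by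
  have hH : ∀ p q, 1 ≤ p → (n ≤ q ∨ cohDim c M + 1 ≤ p) → V c p ((localCohomology a q).obj M) := by
    intro p q hp hh
    rcases hh with hh | hh
    · exact V_torsion p hp _ (h q hh)
    · exact V_semi c (cohDim c M) M (fun p hp => V_of_cohDim c p hp) p hh _ 
        (fun r hr x => lc_kill a q r hr x)
  induction q with
  | zero =>
    intro p hp hc
    have h1 : V c p (LinearMap.ker (Phi I a 0)) := by
      have : Subsingleton (LinearMap.ker (Phi I a 0)) := subsingleton_of_forall_eq 0 fun x => 
        Subtype.ext ((Phi_zero_iff I a x.1).1 x.2)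
      exact V_of_subsingleton _ _ _
    exact ⟨h1, (SES_surj (Phi I a 0) (Phi_surj I a 0)).V2 h1 (hH p 0 hp (by lia))⟩
  | succ q ih =>
    intro p hp hc
    have h1 : V c p (LinearMap.ker (Phi I a (q+1))) := 
      (SES_beta I a q).V3 (V_of_injective c p hp _ (gam_injective a _ (X_inj I q))) 
        (ih (p+1) (by lia) (by lia)).2
    exact ⟨h1, (SES_surj (Phi I a (q+1)) (Phi_surj I a (q+1))).V2 h1 (hH p (q+1) hp (by lia))⟩

lemma gam_radical [IsNoetherianRing R] {b c : Ideal R} (h : c ≤ b.radical) {N : Type} 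
    [AddCommGroup N] [Module R N] {x : N} (hx : x ∈ gam b N) : x ∈ gam c N := by
  obtain ⟨k, hk⟩ := Ideal.exists_pow_le_of_le_radical_of_fg h (IsNoetherian.noetherian c)
  obtain ⟨m, hm⟩ := hx
  refine ⟨k * m, fun r hr => hm r ?_⟩
  rw [pow_mul] at hr
  exact Ideal.pow_right_mono hk m hr

lemma main_iso [IsNoetherianRing R] [Module.Finite R M] (a b c : Ideal R) 
    (hrad : b.radical = (c ⊔ a).radical) (n : ℕ)
    (h : ∀ i, n ≤ i → IsTorsionWrt b ((localCohomology a i).obj M)) (i : ℕ) 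
    (hi : n + cohDim c M ≤ i) :
    Nonempty ((localCohomology a i).obj M ≅ (localCohomology b i).obj M) := by
  let I : InjectiveResolution M := injectiveResolution M
  have hb : ∀ (N : Type) [AddCommGroup N] [Module R N] (x : N), 
      x ∈ gam b N ↔ x ∈ gam c N ∧ x ∈ gam a N := by
    intro N _ _ x
    rw [← gam_sup]
    exact ⟨gam_radical (hrad ▸ Ideal.le_radical), gam_radical (hrad ▸ Ideal.le_radical)⟩
  have hc : ∀ i, n ≤ i → ∀ x : (localCohomology a i).obj M, x ∈ gam c _ := 
    fun i hi x => ((hb _ x).1 (h i hi x)).1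
  have hZ := V_ZB I a c n hc
  have hle : Zc I b i ≤ Zc I a i := fun z hz => ⟨((hb _ z).1 hz.1).2, hz.2⟩
  let Ψ := Phi I a i ∘ₗ Submodule.inclusion hle
  have hΨ : Function.Surjective Ψ := by
    intro x
    obtain ⟨z, hz, rfl⟩ := (SES_surj (Phi I a i) (Phi_surj I a i)).gam_surj 
      (hZ i 1 le_rfl (by lia)).1 x (hc i (by lia) x)
    exact ⟨⟨z.1, (hb _ z.1).2 ⟨(gam_coe z).1 hz, z.2.1⟩, z.2.2⟩, rfl⟩
  have hker : LinearMap.ker Ψ = LinearMap.ker (Phi I b i) := by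
    ext z
    rw [LinearMap.mem_ker, LinearMap.mem_ker]
    change Phi I a i (Submodule.inclusion hle z) = 0 ↔ _
    cases i with
    | zero => 
      rw [Phi_zero_iff, Phi_zero_iff]
      constructor
      · intro h
        have h2 := congrArg Subtype.val h
        exact Subtype.ext h2
      · intro h
        have h2 := congrArg Subtype.val h
        exact Subtype.ext h2
    | succ q =>
      refine (Phi_succ_iff I a q _).trans (Iff.trans ?_ (Phi_succ_iff I b q z).symm)
      constructor
      · intro hy
        have hzk : Submodule.inclusion hle z ∈ LinearMap.ker (Phi I a (q+1)) := 
          (Phi_succ_iff I a q _).2 hy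
        have hzc : (⟨_, hzk⟩ : LinearMap.ker (Phi I a (q+1))) ∈ gam c _ := by
          rw [gam_coe, gam_coe]
          exact ((hb _ z.1).1 z.2.1).1
        obtain ⟨y, hy, hyz⟩ := (SES_beta I a q).gam_surj (hZ q 1 le_rfl (by lia)).2 _ hzc
        refine ⟨y.1, (hb _ _).2 ⟨(gam_coe y).1 hy, y.2⟩, ?_⟩
        rw [← beta_val, hyz]; rfl
      · rintro ⟨y, hy, hyz⟩
        exact ⟨y, ((hb _ y).1 hy).2, hyz⟩
  exact ⟨((Ψ.quotKerEquivOfSurjective hΨ).symm.trans ((Submodule.quotEquivOfEq _ _ hker).trans 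
    ((Phi I b i).quotKerEquivOfSurjective (Phi_surj I b i)))).toModuleIso⟩

end main
end LC

theorem statement12 {R : Type} [CommRing R] [IsNoetherianRing R] (a b : Ideal R) (hab : a ≤ b)
    (M : ModuleCat R) [Module.Finite R M] (n : ℕ)
    (h : ∀ i, n ≤ i → IsTorsionWrt b ((localCohomology a i).obj M)) :
    ∀ i, n + cohDimRel a b M ≤ i →
      Nonempty ((localCohomology a i).obj M ≅ (localCohomology b i).obj M) := by
  intro i hi
  have hne : {m : ℕ | ∃ c : Ideal R, b.radical = (c + a).radical ∧ cohDim c M = m}.Nonempty :=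
    ⟨cohDim b M, b, by rw [Ideal.add_eq_sup, sup_eq_left.2 hab], rfl⟩
  obtain ⟨c, hc, hcd⟩ := Nat.sInf_mem hne
  have hcd' : cohDim c M = cohDimRel a b M := hcd
  exact LC.main_iso a b c hc n h i (by rw [hcd']; exact hi)
end
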